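/- arXiv:1805.04341 — 5 statements merged into one kernel-verified Lean document; each statement's English description precedes it below -/
import Mathlib

section
/- For every permutation w ∈ S_n, the rational number Υ_w := (1/ℓ!) · Σ_{(a_1,…,a_ℓ) ∈ R(w)} a_1·a_2···a_ℓ is a positive integer. -/
/-- The simple transposition `sᵢ = (i, i+1)` acting on `ℕ` (positions are 1-indexed,
so a permutation of `{1,…,n}` is modeled as a permutation of `ℕ` fixing `0` and all `i > n`). -/
def sT (i : ℕ) : Equiv.Perm ℕ := Equiv.swap i (i + 1)

/-- The number of inversions `ℓ(w)` of `w` on `{1,…,n}`. -/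
def len (n : ℕ) (w : Equiv.Perm ℕ) : ℕ :=
  ((Finset.Icc 1 n ×ˢ Finset.Icc 1 n).filter
    (fun p => p.1 < p.2 ∧ w p.2 < w p.1)).card

open scoped Classical in
/-- Macdonald's identity form of the principal specialization `𝔖_w(1,…,1)` of the
Schubert polynomial: `Υ_w = (1/ℓ!) ⬝ Σ_{(a₁,…,a_ℓ) ∈ R(w)} a₁ a₂ ⋯ a_ℓ`, where the sum is
over reduced words of `w`, i.e. tuples with `1 ≤ aᵢ ≤ n − 1` and `w = s_{a₁} ⋯ s_{a_ℓ}`. -/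
noncomputable def Upsilon (n : ℕ) (w : Equiv.Perm ℕ) : ℚ :=
  ((len n w).factorial : ℚ)⁻¹ *
    ∑ a ∈ Finset.univ.filter (fun a : Fin (len n w) → Fin n =>
        (∀ i, 1 ≤ (a i : ℕ)) ∧ (List.ofFn fun i => sT ((a i : ℕ))).prod = w),
      ∏ i, ((a i : ℕ) : ℚ)

/-- `S_n`: permutations of `{1,…,n}`, modeled as permutations of `ℕ`
fixing `0` and every `i > n`. -/
def SymmOn (n : ℕ) : Set (Equiv.Perm ℕ) :=
  {w | ∀ i : ℕ, i = 0 ∨ n < i → w i = i}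

section NilCoxeter

variable {Q : Type*} [Ring Q]

/-- The nilCoxeter relations for a sequence of elements of a ring. -/
structure NilCoxeter (v : ℕ → Q) : Prop where
  sq : ∀ i, v i * v i = 0
  comm : ∀ i j, i + 2 ≤ j → v i * v j = v j * v i
  braid : ∀ i, v i * v (i + 1) * v i = v (i + 1) * v i * v (i + 1)

theorem NilCoxeter.shift {v : ℕ → Q} (h : NilCoxeter v) : NilCoxeter fun i => v (i + 1) :=
  ⟨fun i => h.sq _, fun i j hij => h.comm _ _ (by omega), fun i => h.braid _⟩

/-- The descending product `(1 + v (m - 1)) ⋯ (1 + v 0)`. -/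
def rowProd (v : ℕ → Q) : ℕ → Q
  | 0 => 1
  | m + 1 => (1 + v m) * rowProd v m

/-- The Fomin–Stanley product: the product of the row products of the successive shifts
of `v`. -/
def schubertProd : (ℕ → Q) → ℕ → Q
  | _, 0 => 1
  | v, m + 1 => rowProd v (m + 1) * schubertProd (fun i => v (i + 1)) m

/-- The weighted sum `∑ (k + 1) v k`. -/
def weightedSum (v : ℕ → Q) (m : ℕ) : Q := ∑ k ∈ Finset.range m, ((k : Q) + 1) * v k

/-- The weighted sum `∑ k v k`. -/
def weightedSum' (v : ℕ → Q) (m : ℕ) : Q := ∑ k ∈ Finset.range m, (k : Q) * v k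

theorem NilCoxeter.commute_rowProd {v : ℕ → Q} (h : NilCoxeter v) {m j : ℕ} (hj : m < j) :
    Commute (rowProd v m) (v j) := by
  induction m with
  | zero => exact Commute.one_left _
  | succ m ih =>
    exact ((Commute.one_left _).add_left (h.comm m j (by omega))).mul_left (ih (by omega))

theorem NilCoxeter.commute_weightedSum {v : ℕ → Q} (h : NilCoxeter v) {m j : ℕ} (hj : m < j) :
    Commute (weightedSum v m) (v j) := by
  refine Commute.sum_left _ _ _ fun k hk => ?_
  have hk := Finset.mem_range.1 hk
  exact ((Nat.cast_commute k _).add_left (Commute.one_left _)).mul_left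
    (h.comm k j (by omega))

theorem NilCoxeter.commutator_mul_rowProd {v : ℕ → Q} (h : NilCoxeter v) (m : ℕ) :
    (v m * weightedSum v m - weightedSum v m * v m) * rowProd v m =
      (m : Q) * (v m * rowProd v m - (1 + v m) * rowProd v m * v m) := by
  cases m with
  | zero => simp [weightedSum]
  | succ p =>
    have hD : Commute (weightedSum v p) (v (p + 1)) := h.commute_weightedSum (by omega)
    have hA : Commute (rowProd v p) (v (p + 1)) := h.commute_rowProd (by omega)
    have hc : Commute ((p : Q) + 1) (v (p + 1)) :=
      (Nat.cast_commute p _).add_left (Commute.one_left _)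
    have hs : weightedSum v (p + 1) = weightedSum v p + ((p : Q) + 1) * v p :=
      Finset.sum_range_succ _ _
    have e1 : v (p + 1) * weightedSum v (p + 1) - weightedSum v (p + 1) * v (p + 1) =
        ((p : Q) + 1) * (v (p + 1) * v p - v p * v (p + 1)) := by
      rw [hs]
      generalize (p : Q) + 1 = c at hc
      rw [mul_add, add_mul, hD.eq, ← mul_assoc, ← hc.eq]
      noncomm_ring
    have e2 : (v (p + 1) * v p - v p * v (p + 1)) * (1 + v p) =
        v (p + 1) * (1 + v p) - (1 + v (p + 1)) * (1 + v p) * v (p + 1) := by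
      have h1 := h.sq p
      have h2 := h.sq (p + 1)
      have h3 := h.braid p
      calc _ = v (p + 1) * v p - v p * v (p + 1) + v (p + 1) * (v p * v p)
            - v p * v (p + 1) * v p := by noncomm_ring
        _ = v (p + 1) * v p - v p * v (p + 1) - v (p + 1) * v (p + 1)
            - v (p + 1) * v p * v (p + 1) := by rw [h1, h2, h3]; simp
        _ = _ := by noncomm_ring
    rw [e1, rowProd, mul_assoc, ← mul_assoc _ (1 + v p), e2]
    push_cast
    rw [sub_mul]
    simp only [mul_assoc, hA.eq]

theorem NilCoxeter.derivation_rowProd (θ : Q →+ Q)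
    (hθ : ∀ a b, θ (a * b) = θ a * b + a * θ b) {v : ℕ → Q} (h : NilCoxeter v)
    (hv : ∀ i, θ (v i) = v i) (m : ℕ) :
    θ (rowProd v m) + rowProd v m * weightedSum' v m = weightedSum v m * rowProd v m := by
  have h1 : θ 1 = 0 := by simpa using hθ 1 1
  induction m with
  | zero => simp [rowProd, weightedSum, weightedSum', h1]
  | succ m ih =>
    have hs : weightedSum v (m + 1) = weightedSum v m + ((m : Q) + 1) * v m :=
      Finset.sum_range_succ _ _
    have hs' : weightedSum' v (m + 1) = weightedSum' v m + (m : Q) * v m :=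
      Finset.sum_range_succ _ _
    have hk := h.commutator_mul_rowProd m
    have hc : (m : Q) * ((1 + v m) * rowProd v m) = (1 + v m) * rowProd v m * (m : Q) :=
      (Nat.cast_commute m _).eq
    have hsq := h.sq m
    rw [hs, hs', rowProd, hθ, map_add, h1, hv, zero_add, eq_sub_of_add_eq ih]
    rw [mul_add ((1 + v m) * rowProd v m), ← mul_assoc _ (m : Q), ← hc]
    rw [← sub_eq_zero] at hk ⊢
    calc _ = ((v m * weightedSum v m - weightedSum v m * v m) * rowProd v m -
        (m : Q) * (v m * rowProd v m - (1 + v m) * rowProd v m * v m))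
        - ((m : Q) + 1) * (v m * v m) * rowProd v m := by noncomm_ring
      _ = 0 := by rw [hk, hsq]; simp

theorem NilCoxeter.derivation_schubertProd (θ : Q →+ Q)
    (hθ : ∀ a b, θ (a * b) = θ a * b + a * θ b) {v : ℕ → Q} (h : NilCoxeter v)
    (hv : ∀ i, θ (v i) = v i) (m : ℕ) :
    θ (schubertProd v m) = weightedSum v m * schubertProd v m := by
  induction m generalizing v with
  | zero => simpa [schubertProd, weightedSum] using hθ 1 1
  | succ m ih =>
    have hE : weightedSum' v (m + 1) = weightedSum (fun i => v (i + 1)) m := by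
      simp [weightedSum', weightedSum, Finset.sum_range_succ']
    rw [schubertProd, hθ, ih h.shift fun i => hv _, ← hE, ← mul_assoc, ← mul_assoc, ← add_mul,
      h.derivation_rowProd θ hθ hv]

end NilCoxeter

section Polynomial

open Polynomial

variable {R : Type*} [Ring R]

/-- The Euler operator `X d/dX` on polynomials. -/
noncomputable def eulerOp : R[X] →+ R[X] :=
  (AddMonoidHom.mulLeft X).comp (derivative (R := R)).toAddMonoidHom

theorem eulerOp_apply (f : R[X]) : eulerOp f = X * derivative f := rfl

theorem eulerOp_mul (f g : R[X]) : eulerOp (f * g) = eulerOp f * g + f * eulerOp g := by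
  simp only [eulerOp_apply, derivative_mul, mul_add, ← mul_assoc, X_mul (p := f)]

theorem coeff_zero_rowProd (u : ℕ → R) (m : ℕ) :
    (rowProd (fun i => X * C (u i)) m).coeff 0 = 1 := by
  induction m with
  | zero => simp [rowProd]
  | succ m ih => simp only [rowProd, mul_coeff_zero, ih, coeff_add, coeff_one_zero, coeff_X_zero, zero_mul,
    add_zero, mul_one]

theorem coeff_zero_schubertProd (u : ℕ → R) (m : ℕ) :
    (schubertProd (fun i => X * C (u i)) m).coeff 0 = 1 := by
  induction m generalizing u with
  | zero => simp [schubertProd]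
  | succ m ih =>
    simp only [schubertProd, mul_coeff_zero, coeff_zero_rowProd, one_mul]
    exact ih fun i => u (i + 1)

theorem NilCoxeter.X_mul_C {u : ℕ → R} (h : NilCoxeter u) :
    NilCoxeter fun i => (X * C (u i) : R[X]) := by
  have e : ∀ a b : R, (X * C a * (X * C b) : R[X]) = X * X * C (a * b) := fun a b => by
    rw [C_mul, mul_assoc, ← mul_assoc (C a), ← Polynomial.X_mul_C, mul_assoc, mul_assoc]
  refine ⟨fun i => ?_, fun i j hij => ?_, fun i => ?_⟩
  · simp only [e, h.sq, C_0, mul_zero]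
  · simp only [e, h.comm i j hij]
  · have e3 : ∀ a b c : R,
        (X * C a * (X * C b) * (X * C c) : R[X]) = X * X * X * C (a * b * c) := fun a b c => by
      rw [e, C_mul (a := a * b), mul_assoc, ← mul_assoc (C _), ← Polynomial.X_mul_C]
      simp only [mul_assoc]
    simp only [e3, h.braid]

/-- The weighted sum of the generators of a nilCoxeter algebra has divided powers. -/
theorem NilCoxeter.factorial_dvd_weightedSum_pow {u : ℕ → R} (h : NilCoxeter u) (m k : ℕ) :
    ∃ c : R, weightedSum u m ^ k = (k.factorial : R) * c := by
  set S := schubertProd (fun i => (X * C (u i) : R[X])) m with hS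
  have hd : eulerOp S = weightedSum (fun i => (X * C (u i) : R[X])) m * S :=
    h.X_mul_C.derivation_schubertProd eulerOp eulerOp_mul
      (fun i => by simp [eulerOp_apply]) m
  have hw : weightedSum (fun i => (X * C (u i) : R[X])) m = X * C (weightedSum u m) := by
    simp only [weightedSum, map_sum, Finset.mul_sum]
    refine Finset.sum_congr rfl fun k _ => ?_
    have : ((k : R[X]) + 1) = C ((k : R) + 1) := by simp
    rw [this, ← mul_assoc, ← Polynomial.X_mul_C, C_mul, mul_assoc]
  refine ⟨S.coeff k, ?_⟩
  induction k with
  | zero => rw [hS, coeff_zero_schubertProd]; simp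
  | succ k ih =>
    have hk := congrArg (fun p => p.coeff (k + 1)) hd
    simp only [hw, eulerOp_apply, mul_assoc, coeff_X_mul, coeff_C_mul, coeff_derivative] at hk
    rw [pow_succ', ih, ← mul_assoc, ← (Nat.cast_commute k.factorial _).eq, mul_assoc, ← hk,
      Nat.factorial_succ]
    have : Commute (S.coeff (k + 1)) ((k : R) + 1) :=
      (Nat.commute_cast _ k).add_right (Commute.one_right _)
    rw [this.eq, ← mul_assoc]
    congr 1
    rw [mul_comm (k + 1)]
    push_cast
    rfl

end Polynomial

section Permutations

open Equiv

theorem sT_mul_self (a : ℕ) : sT a * sT a = 1 := swap_mul_self _ _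

theorem sT_inv (a : ℕ) : (sT a)⁻¹ = sT a := swap_inv _ _

theorem sT_apply (a i : ℕ) : sT a i = if i = a then a + 1 else if i = a + 1 then a else i :=
  swap_apply_def _ _ _

/-- The nilCoxeter generator: left multiplication by `sT a` when it increases the length,
and `0` otherwise. -/
noncomputable def nilGen (a : ℕ) : Module.End ℤ (Perm ℕ →₀ ℤ) :=
  Finsupp.linearCombination ℤ fun v : Perm ℕ =>
    if v⁻¹ a < v⁻¹ (a + 1) then Finsupp.single (sT a * v) 1 else 0

theorem nilGen_single (a : ℕ) (v : Perm ℕ) :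
    nilGen a (Finsupp.single v 1) =
      if v⁻¹ a < v⁻¹ (a + 1) then Finsupp.single (sT a * v) 1 else 0 := by
  simp [nilGen]

theorem inv_sT_mul_apply (a : ℕ) (v : Perm ℕ) (i : ℕ) :
    (sT a * v)⁻¹ i = v⁻¹ (if i = a then a + 1 else if i = a + 1 then a else i) := by
  rw [mul_inv_rev, sT_inv, Perm.mul_apply, sT_apply]

theorem sT_comm {a b : ℕ} (h : a + 2 ≤ b) : sT a * sT b = sT b * sT a := by
  ext i
  simp only [Perm.mul_apply, sT_apply]
  split_ifs <;> omega

theorem sT_braid (a : ℕ) : sT a * sT (a + 1) * sT a = sT (a + 1) * sT a * sT (a + 1) := by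
  ext i
  simp only [Perm.mul_apply, sT_apply]
  split_ifs <;> omega

theorem nilCoxeter_nilGen : NilCoxeter nilGen := by
  refine ⟨fun a => ?_, fun a b hab => ?_, fun a => ?_⟩
  all_goals
    refine Finsupp.lhom_ext' fun v => LinearMap.ext_ring ?_
    simp only [LinearMap.comp_apply, Finsupp.lsingle_apply, Module.End.mul_apply,
      LinearMap.zero_apply]
  · rw [nilGen_single]
    split_ifs with h
    · rw [nilGen_single, if_neg]
      simp only [inv_sT_mul_apply, Nat.succ_ne_self, if_true, if_false]
      omega
    · simp
  · have h1 : (b = a) = False := by simp; omega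
    have h2 : (b = a + 1) = False := by simp; omega
    have h3 : (b + 1 = a) = False := by simp; omega
    have h4 : (b + 1 = a + 1) = False := by simp; omega
    have h1' : (a = b) = False := by simp; omega
    have h2' : (a + 1 = b) = False := by simp; omega
    have h3' : (a = b + 1) = False := by simp; omega
    have h4' : (a + 1 = b + 1) = False := by simp; omega
    rw [nilGen_single, nilGen_single, apply_ite (nilGen a), apply_ite (nilGen b)]
    simp only [nilGen_single, map_zero, inv_sT_mul_apply, h1, h2, h3, h4, h1', h2', h3', h4',
      if_false, ← mul_assoc, sT_comm hab]
    split_ifs <;> rfl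
  · have e1 : (a + 1 = a) = False := by simp
    have e2 : (a + 1 + 1 = a) = False := by simp; omega
    have e3 : (a + 1 + 1 = a + 1) = False := by simp
    have e4 : (a = a + 1) = False := by simp
    have e5 : (a = a + 1 + 1) = False := by simp; omega
    have e6 : (a + 1 = a + 1 + 1) = False := by simp
    simp only [nilGen_single, apply_ite (nilGen a), apply_ite (nilGen (a + 1)), map_zero,
      inv_sT_mul_apply, e1, e2, e3, e4, e5, e6, if_false, if_true]
    simp only [← mul_assoc, sT_braid]
    split_ifs <;> rfl

/-- The inversion set whose cardinality is `len n w`. -/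
def invSet (n : ℕ) (w : Perm ℕ) : Finset (ℕ × ℕ) :=
  (Finset.Icc 1 n ×ˢ Finset.Icc 1 n).filter (fun p => p.1 < p.2 ∧ w p.2 < w p.1)

theorem len_eq_card (n : ℕ) (w : Perm ℕ) : len n w = (invSet n w).card := rfl

theorem mem_invSet {n : ℕ} {w : Perm ℕ} {p : ℕ × ℕ} :
    p ∈ invSet n w ↔
      ((1 ≤ p.1 ∧ p.1 ≤ n) ∧ 1 ≤ p.2 ∧ p.2 ≤ n) ∧ p.1 < p.2 ∧ w p.2 < w p.1 := by
  simp [invSet]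

theorem invSet_sT_mul_subset_insert (n a : ℕ) (v : Perm ℕ) :
    invSet n (sT a * v) ⊆ insert (v⁻¹ a, v⁻¹ (a + 1)) (invSet n v) := by
  rintro ⟨i, j⟩ h
  rw [mem_invSet] at h
  rw [Finset.mem_insert, mem_invSet, Prod.mk.injEq, Perm.eq_inv_iff_eq, Perm.eq_inv_iff_eq]
  obtain ⟨h1, h2, h3⟩ := h
  simp only [Perm.mul_apply, sT_apply] at h1 h2 h3 ⊢
  by_cases hq : v i = a ∧ v j = a + 1
  · exact Or.inl hq
  · refine Or.inr ⟨h1, h2, ?_⟩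
    have hne : v i ≠ v j := fun h => h2.ne (v.injective h)
    split_ifs at h3 <;> omega

theorem len_sT_mul_le (n a : ℕ) (v : Perm ℕ) : len n (sT a * v) ≤ len n v + 1 :=
  (Finset.card_le_card (invSet_sT_mul_subset_insert n a v)).trans (Finset.card_insert_le _ _)

theorem invSet_sT_mul_subset (n a : ℕ) (v : Perm ℕ) (h : v⁻¹ (a + 1) < v⁻¹ a) :
    invSet n (sT a * v) ⊆ invSet n v := fun p hp => by
  rcases Finset.mem_insert.1 (invSet_sT_mul_subset_insert n a v hp) with rfl | h'
  · have := (mem_invSet.1 hp).2.1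
    simp only at this
    omega
  · exact h'

theorem len_one (n : ℕ) : len n 1 = 0 := by
  rw [len_eq_card, Finset.card_eq_zero, Finset.eq_empty_iff_forall_notMem]
  intro p hp
  have := (mem_invSet.1 hp).2
  simp only [Perm.one_apply] at this
  omega

theorem len_prod_le (n : ℕ) (l : List ℕ) : len n (l.map sT).prod ≤ l.length := by
  induction l with
  | nil => simp [len_one]
  | cons a l ih =>
    have := len_sT_mul_le n a (l.map sT).prod
    simp only [List.map_cons, List.prod_cons, List.length_cons]
    omega

theorem prod_nilGen_eq_single (n : ℕ) (l : List ℕ) (h : len n (l.map sT).prod = l.length) :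
    (l.map nilGen).prod (Finsupp.single 1 1) = Finsupp.single (l.map sT).prod 1 := by
  induction l with
  | nil => simp
  | cons a l ih =>
    simp only [List.map_cons, List.prod_cons, List.length_cons, Module.End.mul_apply] at h ⊢
    have h1 := len_sT_mul_le n a (l.map sT).prod
    have h2 := len_prod_le n l
    rw [ih (by omega), nilGen_single, if_pos]
    by_contra hlt
    have hne : (l.map sT).prod⁻¹ a ≠ (l.map sT).prod⁻¹ (a + 1) := fun h =>
      absurd ((l.map sT).prod⁻¹.injective h) (by omega)
    have := Finset.card_le_card (invSet_sT_mul_subset n a (l.map sT).prod (by omega))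
    rw [← len_eq_card, ← len_eq_card] at this
    omega

theorem prod_nilGen_eq_zero_or (l : List ℕ) :
    (l.map nilGen).prod (Finsupp.single 1 1) = 0 ∨
      (l.map nilGen).prod (Finsupp.single 1 1) = Finsupp.single (l.map sT).prod 1 := by
  induction l with
  | nil => simp
  | cons a l ih =>
    simp only [List.map_cons, List.prod_cons, Module.End.mul_apply]
    rcases ih with h | h
    · simp [h]
    · rw [h, nilGen_single]
      split_ifs <;> simp

open scoped Classical in
theorem prod_nilGen_apply (n : ℕ) (w : Perm ℕ) (l : List ℕ) (h : l.length = len n w) :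
    (l.map nilGen).prod (Finsupp.single 1 1) w = if (l.map sT).prod = w then 1 else 0 := by
  split_ifs with hw
  · rw [prod_nilGen_eq_single n l (by rw [hw, h]), hw, Finsupp.single_eq_same]
  · rcases prod_nilGen_eq_zero_or l with h | h
    · simp [h]
    · rw [h, Finsupp.single_apply, if_neg hw]

theorem sum_pow_eq_sum_words {R : Type*} [Ring R] (n : ℕ) (u : ℕ → R) (k : ℕ) :
    (∑ a : Fin n, ((a : ℕ) : R) * u a) ^ k =
      ∑ f : Fin k → Fin n, ((∏ i, (f i : ℕ) : ℕ) : R) *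
        ((List.ofFn fun i => (f i : ℕ)).map u).prod := by
  induction k with
  | zero => simp
  | succ k ih =>
    rw [pow_succ', ih, ← (Fin.consEquiv fun _ => Fin n).sum_comp, Fintype.sum_prod_type,
      Finset.sum_mul_sum]
    refine Finset.sum_congr rfl fun a _ => Finset.sum_congr rfl fun f _ => ?_
    simp only [Fin.consEquiv_apply, Fin.prod_univ_succ, Fin.cons_zero, Fin.cons_succ,
      List.ofFn_succ, List.map_cons, List.prod_cons, Nat.cast_mul, mul_assoc]
    congr 1
    rw [← mul_assoc, ← mul_assoc, (Nat.cast_commute _ (u a)).eq]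

theorem sum_fin_eq_weightedSum {R : Type*} [Ring R] (n : ℕ) (u : ℕ → R) :
    ∑ a : Fin n, ((a : ℕ) : R) * u a = weightedSum (fun i => u (i + 1)) (n - 1) := by
  rw [Fin.sum_univ_eq_sum_range (fun a => (a : R) * u a)]
  cases n with
  | zero => simp [weightedSum]
  | succ m => simp [weightedSum, Finset.sum_range_succ']

theorem eq_one_of_forall_inv_lt (w : Perm ℕ) (h : ∀ a, w⁻¹ a < w⁻¹ (a + 1)) : w = 1 := by
  have hm : StrictMono (w⁻¹ : Perm ℕ) := strictMono_nat_of_lt_succ h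
  ext i
  refine le_antisymm ?_ ?_
  · simpa using hm.id_le (w i)
  · have hm' : StrictMono w := fun x y hxy => by
      rw [← hm.lt_iff_lt]
      simpa using hxy
    simpa using hm'.id_le i

theorem SymmOn.le_of_le {n : ℕ} {w : Perm ℕ} (hw : w ∈ SymmOn n) {i : ℕ} (h : i ≤ n) :
    w i ≤ n := by
  by_contra hlt
  have := w.injective (hw (w i) (Or.inr (by omega)))
  omega

theorem SymmOn.inv_mem {n : ℕ} {w : Perm ℕ} (hw : w ∈ SymmOn n) : w⁻¹ ∈ SymmOn n :=
  fun i hi => by rw [Perm.inv_eq_iff_eq, hw i hi]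

theorem exists_descent {n : ℕ} {w : Perm ℕ} (hw : w ∈ SymmOn n) (h1 : w ≠ 1) :
    ∃ a, 1 ≤ a ∧ a < n ∧ w⁻¹ (a + 1) < w⁻¹ a := by
  by_contra! hno
  refine h1 (eq_one_of_forall_inv_lt w fun a => ?_)
  have hne : w⁻¹ a ≠ w⁻¹ (a + 1) := fun h => absurd (w⁻¹.injective h) (by omega)
  have hi := SymmOn.inv_mem hw
  rcases Nat.eq_zero_or_pos a with rfl | ha
  · have := hi 0 (Or.inl rfl)
    omega
  · rcases lt_or_ge a n with han | han
    · have := hno a ha han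
      omega
    · have h2 := hi (a + 1) (Or.inr (by omega))
      rcases han.eq_or_lt with rfl | hlt
      · have := SymmOn.le_of_le hi (le_refl n)
        omega
      · have := hi a (Or.inr hlt)
        omega

theorem len_sT_mul_lt {n a : ℕ} {w : Perm ℕ} (hw : w ∈ SymmOn n) (ha : 1 ≤ a) (han : a < n)
    (h : w⁻¹ (a + 1) < w⁻¹ a) : len n (sT a * w) < len n w := by
  have hi := SymmOn.inv_mem hw
  have h0 : w⁻¹ (a + 1) ≠ 0 := fun h0 => by
    have := w⁻¹.injective (h0.trans (hi 0 (Or.inl rfl)).symm)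
    omega
  have hle : w⁻¹ a ≤ n := SymmOn.le_of_le hi han.le
  refine Finset.card_lt_card ((Finset.ssubset_iff_of_subset
    (invSet_sT_mul_subset n a w h)).2 ⟨(w⁻¹ (a + 1), w⁻¹ a), ?_, ?_⟩)
  · rw [mem_invSet]
    have e : ∀ i, w (w⁻¹ i) = i := w.apply_symm_apply
    simp only [e]
    omega
  · rw [mem_invSet]
    simp [sT_apply]

theorem sT_mul_mem {n a : ℕ} {w : Perm ℕ} (hw : w ∈ SymmOn n) (ha : 1 ≤ a) (han : a < n) :
    sT a * w ∈ SymmOn n := fun i hi => by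
  rw [Perm.mul_apply, hw i hi, sT_apply]
  split_ifs <;> omega

theorem exists_reduced_word (n k : ℕ) (w : Perm ℕ) (hw : w ∈ SymmOn n) (hk : len n w = k) :
    ∃ f : Fin k → Fin n, (∀ i, 1 ≤ (f i : ℕ)) ∧
      (List.ofFn fun i => sT (f i : ℕ)).prod = w := by
  induction k generalizing w with
  | zero =>
    refine ⟨Fin.elim0, fun i => i.elim0, ?_⟩
    by_contra h1
    obtain ⟨a, ha, han, h⟩ := exists_descent hw (fun h => h1 (by simp [h]))
    have := len_sT_mul_lt hw ha han h
    omega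
  | succ k ih =>
    have h1 : w ≠ 1 := by
      rintro rfl
      rw [len_one] at hk
      omega
    obtain ⟨a, ha, han, h⟩ := exists_descent hw h1
    have hlt := len_sT_mul_lt hw ha han h
    have hle := len_sT_mul_le n a (sT a * w)
    rw [← mul_assoc, sT_mul_self, one_mul] at hle
    obtain ⟨f, hf, hp⟩ := ih (sT a * w) (sT_mul_mem hw ha han) (by omega)
    refine ⟨Fin.cons ⟨a, han⟩ f, Fin.cases (by simpa using ha) (by simpa using hf), ?_⟩
    simp [List.ofFn_succ, hp, ← mul_assoc, sT_mul_self]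

open scoped Classical in
theorem factorial_dvd_sum_reduced_words (n : ℕ) (w : Perm ℕ) :
    ∃ c : ℤ, ∑ a ∈ Finset.univ.filter (fun a : Fin (len n w) → Fin n =>
        (∀ i, 1 ≤ (a i : ℕ)) ∧ (List.ofFn fun i => sT ((a i : ℕ))).prod = w),
      ∏ i, ((a i : ℕ) : ℤ) = ((len n w).factorial : ℤ) * c := by
  obtain ⟨c, hc⟩ := nilCoxeter_nilGen.shift.factorial_dvd_weightedSum_pow (n - 1) (len n w)
  rw [← sum_fin_eq_weightedSum n nilGen, sum_pow_eq_sum_words] at hc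
  refine ⟨c (Finsupp.single 1 1) w, ?_⟩
  have hcw := congrArg (fun T : Module.End ℤ (Perm ℕ →₀ ℤ) => T (Finsupp.single 1 1) w) hc
  simp only [← nsmul_eq_mul, LinearMap.sum_apply, LinearMap.smul_apply, Finsupp.finsetSum_apply,
    Finsupp.smul_apply] at hcw
  rw [← nsmul_eq_mul, ← hcw, Finset.sum_filter]
  refine Finset.sum_congr rfl fun f _ => ?_
  rw [prod_nilGen_apply n w _ (by simp), List.map_ofFn]
  by_cases hf : ∀ i, 1 ≤ (f i : ℕ)
  · simp only [hf, implies_true, true_and, Function.comp_def]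
    split_ifs <;> simp
  · obtain ⟨i, hi⟩ := not_forall.1 hf
    rw [if_neg fun h => hf h.1, Finset.prod_eq_zero (Finset.mem_univ i) (by omega), zero_smul]

end Permutations

/-- For every permutation `w ∈ Sₙ`, the rational number `Υ_w` is a positive integer. -/
theorem upsilon_pos_integer (n : ℕ) (w : Equiv.Perm ℕ) (hw : w ∈ SymmOn n) :
    ∃ k : ℕ, 0 < k ∧ Upsilon n w = (k : ℚ) := by
  classical
  obtain ⟨c, hc⟩ := factorial_dvd_sum_reduced_words n w
  have hfac : (0 : ℚ) < ((len n w).factorial : ℚ) := by exact_mod_cast Nat.factorial_pos _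
  have hU : Upsilon n w = (c : ℚ) := by
    rw [Upsilon, inv_mul_eq_iff_eq_mul₀ hfac.ne']
    exact_mod_cast hc
  have hpos : 0 < Upsilon n w := by
    obtain ⟨f, hf, hp⟩ := exists_reduced_word n _ w hw rfl
    refine mul_pos (inv_pos.2 hfac) (Finset.sum_pos (fun a ha => ?_)
      ⟨f, Finset.mem_filter.2 ⟨Finset.mem_univ _, hf, hp⟩⟩)
    exact Finset.prod_pos fun i _ => by exact_mod_cast (Finset.mem_filter.1 ha).2.1 i
  rw [hU] at hpos
  have hc0 : 0 < c := by exact_mod_cast hpos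
  refine ⟨c.toNat, by omega, ?_⟩
  rw [hU]
  exact_mod_cast (Int.toNat_of_nonneg hc0.le).symm
end

section
/- There exist a unique real γ > 0 and a unique α ∈ (0,1) such that: (1) 2γα + f′(α) = 0, and (2) γα² + f(α) = γ. Moreover, for this γ, the maximum of f(x) + γx² over x ∈ [0,1) equals γ and is attained at x = α. -/
/-- The function `f(x) = x² log x − ½(1−x)² log(1−x) − ½(1+x)² log(1+x) + 2x log 2`
(natural logarithms; `Real.log 0 = 0` gives the continuous extension `f 0 = f 1 = 0`). -/
noncomputable def f (x : ℝ) : ℝ :=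
  x ^ 2 * Real.log x - (1 / 2) * (1 - x) ^ 2 * Real.log (1 - x)
    - (1 / 2) * (1 + x) ^ 2 * Real.log (1 + x) + 2 * x * Real.log 2

namespace MaxQuadratic

/-- The first derivative of `f` on `(0,1)`. -/
noncomputable def fDeriv (x : ℝ) : ℝ :=
  2 * (x * Real.log x) + (1 - x) * Real.log (1 - x) - (1 + x) * Real.log (1 + x) + 2 * Real.log 2

/-- The second derivative of `f` on `(0,1)`. -/
noncomputable def fDeriv2 (x : ℝ) : ℝ :=
  2 * Real.log x - Real.log (1 - x) - Real.log (1 + x)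

/-- The numerator of the derivative of `f x / (1 - x ^ 2)`. -/
noncomputable def num (x : ℝ) : ℝ := fDeriv x * (1 - x ^ 2) + 2 * x * f x

/-- The derivative of `num` on `(0,1)`. -/
noncomputable def numDeriv (x : ℝ) : ℝ := (1 - x ^ 2) * fDeriv2 x + 2 * f x

/-- Half the derivative of `numDeriv` on `(0,1)`. -/
noncomputable def numDeriv2 (x : ℝ) : ℝ := 1 / x - x * fDeriv2 x + fDeriv x

theorem continuous_sub_mul_log : Continuous fun x : ℝ => (1 - x) * Real.log (1 - x) :=
  Real.continuous_mul_log.comp (continuous_const.sub continuous_id)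

theorem continuous_add_mul_log : Continuous fun x : ℝ => (1 + x) * Real.log (1 + x) :=
  Real.continuous_mul_log.comp (continuous_const.add continuous_id)

theorem continuous_f : Continuous f := by
  have h0 := Real.continuous_mul_log
  have h1 := continuous_sub_mul_log
  have h2 := continuous_add_mul_log
  have h : f = fun x => x * (x * Real.log x) - (1 / 2) * (1 - x) * ((1 - x) * Real.log (1 - x))
      - (1 / 2) * (1 + x) * ((1 + x) * Real.log (1 + x)) + 2 * x * Real.log 2 := by
    funext x
    simp only [f]
    ring
  rw [h]
  fun_prop

theorem continuous_fDeriv : Continuous fDeriv := by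
  have h0 := Real.continuous_mul_log
  have h1 := continuous_sub_mul_log
  have h2 := continuous_add_mul_log
  unfold fDeriv
  fun_prop

theorem continuous_num : Continuous num := by
  have h0 := continuous_f
  have h1 := continuous_fDeriv
  unfold num
  fun_prop

theorem continuousOn_numDeriv : ContinuousOn numDeriv (Set.Ioi 0) := by
  have h0 := continuous_f
  have h1 := continuous_sub_mul_log
  have h2 := continuous_add_mul_log
  have hl : ContinuousOn Real.log (Set.Ioi 0) :=
    Real.continuousOn_log.mono fun x (hx : 0 < x) => hx.ne'
  have h : numDeriv = fun x => 2 * (1 - x ^ 2) * Real.log x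
      - (1 + x) * ((1 - x) * Real.log (1 - x)) - (1 - x) * ((1 + x) * Real.log (1 + x))
      + 2 * f x := by
    funext x
    simp only [numDeriv, fDeriv2]
    ring
  rw [h]
  fun_prop

section Derivatives

variable {x : ℝ}

theorem hasDerivAt_log_one_sub (hx : x < 1) :
    HasDerivAt (fun y : ℝ => Real.log (1 - y)) (-1 / (1 - x)) x :=
  ((hasDerivAt_id x).const_sub 1).log (sub_pos.2 hx).ne'

theorem hasDerivAt_log_one_add (hx : 0 < x) :
    HasDerivAt (fun y : ℝ => Real.log (1 + y)) (1 / (1 + x)) x :=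
  ((hasDerivAt_id x).const_add 1).log (by simp only [id]; positivity)

theorem hasDerivAt_f (h0 : 0 < x) (h1 : x < 1) : HasDerivAt f (fDeriv x) x := by
  have hi := hasDerivAt_id x
  have := (((((hi.pow 2).mul (Real.hasDerivAt_log h0.ne')).sub
    ((((hi.const_sub 1).pow 2).const_mul (1 / 2)).mul (hasDerivAt_log_one_sub h1))).sub
    ((((hi.const_add 1).pow 2).const_mul (1 / 2)).mul (hasDerivAt_log_one_add h0))).add
    ((hi.const_mul 2).mul_const (Real.log 2)))
  refine this.congr_deriv ?_
  have : 1 - x ≠ 0 := (sub_pos.2 h1).ne'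
  have : 1 + x ≠ 0 := by positivity
  simp [fDeriv]
  field_simp
  ring

theorem hasDerivAt_fDeriv (h0 : 0 < x) (h1 : x < 1) : HasDerivAt fDeriv (fDeriv2 x) x := by
  have hi := hasDerivAt_id x
  have := ((((hi.mul (Real.hasDerivAt_log h0.ne')).const_mul 2).add
    ((hi.const_sub 1).mul (hasDerivAt_log_one_sub h1))).sub
    ((hi.const_add 1).mul (hasDerivAt_log_one_add h0))).add_const (2 * Real.log 2)
  refine this.congr_deriv ?_
  have : 1 - x ≠ 0 := (sub_pos.2 h1).ne'
  have : 1 + x ≠ 0 := by positivity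
  simp [fDeriv2]
  field_simp
  ring

theorem hasDerivAt_fDeriv2 (h0 : 0 < x) (h1 : x < 1) :
    HasDerivAt fDeriv2 (2 / (x * (1 - x ^ 2))) x := by
  have := (((Real.hasDerivAt_log h0.ne').const_mul 2).sub (hasDerivAt_log_one_sub h1)).sub
    (hasDerivAt_log_one_add h0)
  refine this.congr_deriv ?_
  have : 1 - x ≠ 0 := (sub_pos.2 h1).ne'
  have : 1 + x ≠ 0 := by positivity
  rw [show 1 - x ^ 2 = (1 - x) * (1 + x) by ring]
  field_simp
  ring

theorem hasDerivAt_one_sub_sq (x : ℝ) : HasDerivAt (fun y : ℝ => 1 - y ^ 2) (-(2 * x)) x := by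
  simpa using (hasDerivAt_pow 2 x).const_sub 1

theorem hasDerivAt_num (h0 : 0 < x) (h1 : x < 1) : HasDerivAt num (numDeriv x) x := by
  have := ((hasDerivAt_fDeriv h0 h1).mul (hasDerivAt_one_sub_sq x)).add
    (((hasDerivAt_id x).const_mul 2).mul (hasDerivAt_f h0 h1))
  refine this.congr_deriv ?_
  simp [numDeriv]
  ring

theorem hasDerivAt_numDeriv (h0 : 0 < x) (h1 : x < 1) :
    HasDerivAt numDeriv (2 * numDeriv2 x) x := by
  have := ((hasDerivAt_one_sub_sq x).mul (hasDerivAt_fDeriv2 h0 h1)).add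
    ((hasDerivAt_f h0 h1).const_mul 2)
  refine this.congr_deriv ?_
  have : 1 - x ^ 2 ≠ 0 := by nlinarith
  simp only [numDeriv2]
  field_simp
  ring

theorem hasDerivAt_numDeriv2 (h0 : 0 < x) (h1 : x < 1) :
    HasDerivAt numDeriv2 (-(1 / x ^ 2) - 2 / (1 - x ^ 2)) x := by
  have := (((hasDerivAt_const x (1 : ℝ)).div (hasDerivAt_id x) h0.ne').sub
    ((hasDerivAt_id x).mul (hasDerivAt_fDeriv2 h0 h1))).add (hasDerivAt_fDeriv h0 h1)
  refine this.congr_deriv ?_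
  have : 1 - x ^ 2 ≠ 0 := by nlinarith
  simp
  field_simp
  ring

theorem hasDerivAt_quotient (h0 : 0 < x) (h1 : x < 1) :
    HasDerivAt (fun y => f y / (1 - y ^ 2)) (num x / (1 - x ^ 2) ^ 2) x := by
  have h : 1 - x ^ 2 ≠ 0 := by nlinarith
  refine ((hasDerivAt_f h0 h1).div (hasDerivAt_one_sub_sq x) h).congr_deriv ?_
  simp only [num]
  ring

end Derivatives

theorem strictAntiOn_numDeriv2 : StrictAntiOn numDeriv2 (Set.Ioo 0 1) := by
  refine strictAntiOn_of_deriv_neg (convex_Ioo 0 1)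
    (fun x hx => (hasDerivAt_numDeriv2 hx.1 hx.2).continuousAt.continuousWithinAt) ?_
  intro x hx
  rw [interior_Ioo] at hx
  rw [(hasDerivAt_numDeriv2 hx.1 hx.2).deriv]
  have h0 := hx.1
  have h : 0 < 1 - x ^ 2 := by nlinarith [hx.1, hx.2]
  have h2 : 0 < 1 / x ^ 2 := by positivity
  have h3 : 0 < 2 / (1 - x ^ 2) := by positivity
  linarith

theorem num_zero : num 0 = 2 * Real.log 2 := by simp [num, fDeriv]

theorem num_one : num 1 = 0 := by
  simp [num, f]
  norm_num

theorem numDeriv_one : numDeriv 1 = 0 := by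
  simp [numDeriv, f]
  norm_num

theorem num_half_neg : num (1 / 2) < 0 := by
  have h3 : Real.log (1 + 1 / 2) = Real.log 3 - Real.log 2 := by
    rw [← Real.log_div (by norm_num) (by norm_num)]
    norm_num
  have h2 : Real.log (1 / 2) = -Real.log 2 := by simp
  have h : 14 * Real.log 2 < 9 * Real.log 3 := by
    have := Real.log_lt_log (x := 2 ^ 14) (y := 3 ^ 9) (by norm_num) (by norm_num)
    simpa [Real.log_pow] using this
  simp only [num, fDeriv, f, h3, show (1 : ℝ) - 1 / 2 = 1 / 2 by norm_num, h2]
  linarith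

/-- Three zeros of `num` in `(0,1]` would produce, by Rolle's theorem, two zeros of the
strictly decreasing function `numDeriv2`. -/
theorem not_two_zeros {a b : ℝ} (ha : 0 < a) (hab : a < b) (hb : b < 1) (hna : num a = 0)
    (hnb : num b = 0) : False := by
  obtain ⟨c, hc, hnc⟩ := exists_hasDerivAt_eq_zero hab continuous_num.continuousOn
    (hna.trans hnb.symm) fun x hx => hasDerivAt_num (ha.trans hx.1) (hx.2.trans hb)
  obtain ⟨d, hd, hnd⟩ := exists_hasDerivAt_eq_zero hb continuous_num.continuousOn
    (hnb.trans num_one.symm) fun x hx => hasDerivAt_num ((ha.trans hab).trans hx.1) hx.2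
  have hc0 : 0 < c := ha.trans hc.1
  have hd0 : 0 < d := (ha.trans hab).trans hd.1
  obtain ⟨p, hp, hnp⟩ := exists_hasDerivAt_eq_zero (hc.2.trans hd.1)
    (continuousOn_numDeriv.mono fun x hx => hc0.trans_le hx.1)
    (hnc.trans hnd.symm) fun x hx => hasDerivAt_numDeriv (hc0.trans hx.1) (hx.2.trans hd.2)
  obtain ⟨q, hq, hnq⟩ := exists_hasDerivAt_eq_zero hd.2
    (continuousOn_numDeriv.mono fun x hx => hd0.trans_le hx.1)
    (hnd.trans numDeriv_one.symm) fun x hx => hasDerivAt_numDeriv (hd0.trans hx.1) hx.2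
  have := strictAntiOn_numDeriv2 ⟨hc0.trans hp.1, hp.2.trans hd.2⟩ ⟨hd0.trans hq.1, hq.2⟩
    (hp.2.trans hq.1)
  linarith

theorem num_zero_unique {a b : ℝ} (ha : a ∈ Set.Ioo (0 : ℝ) 1) (hb : b ∈ Set.Ioo (0 : ℝ) 1)
    (hna : num a = 0) (hnb : num b = 0) : a = b := by
  rcases lt_trichotomy a b with h | h | h
  · exact (not_two_zeros ha.1 h hb.2 hna hnb).elim
  · exact h
  · exact (not_two_zeros hb.1 h ha.2 hnb hna).elim

theorem exists_num_eq_zero {x : ℝ} (hx : 0 < x) (hn : num x ≤ 0) :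
    ∃ a, 0 < a ∧ a ≤ x ∧ num a = 0 := by
  have h0 : 0 < num 0 := by
    rw [num_zero]
    positivity
  obtain ⟨a, ha, hna⟩ := intermediate_value_Icc' hx.le continuous_num.continuousOn ⟨hn, h0.le⟩
  refine ⟨a, lt_of_le_of_ne ha.1 ?_, ha.2, hna⟩
  rintro rfl
  exact h0.ne' hna

section CriticalPoint

variable {a : ℝ}

theorem num_pos_of_lt (ha : a ∈ Set.Ioo (0 : ℝ) 1) (hna : num a = 0) {x : ℝ} (hx : 0 < x)
    (hxa : x < a) : 0 < num x := by
  by_contra! h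
  obtain ⟨b, hb0, hbx, hnb⟩ := exists_num_eq_zero hx h
  have := num_zero_unique ha ⟨hb0, (hbx.trans_lt hxa).trans ha.2⟩ hna hnb
  linarith

theorem num_neg_of_gt (ha : a ∈ Set.Ioo (0 : ℝ) 1) (hna : num a = 0) {x : ℝ} (hx : x < 1)
    (hax : a < x) : num x < 0 := by
  have hhalf : a < 1 / 2 := by
    by_contra! h
    rcases h.eq_or_lt with h | h
    · exact num_half_neg.ne (h ▸ hna)
    · exact (num_pos_of_lt ha hna (by norm_num) h).not_gt num_half_neg
  by_contra! h
  obtain ⟨b, hb, hnb⟩ := intermediate_value_uIcc (a := 1 / 2) (b := x)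
    continuous_num.continuousOn (Set.mem_uIcc_of_le num_half_neg.le h)
  have hab : a < b := (lt_min hhalf hax).trans_le hb.1
  have hb1 : b < 1 := hb.2.trans_lt (max_lt (by norm_num) hx)
  exact hab.ne (num_zero_unique ha ⟨ha.1.trans hab, hb1⟩ hna hnb)

theorem continuousOn_quotient : ContinuousOn (fun y => f y / (1 - y ^ 2)) (Set.Ico 0 1) := by
  refine continuous_f.continuousOn.div (by fun_prop) fun x hx => ?_
  nlinarith [hx.1, hx.2]

theorem strictMonoOn_quotient (ha : a ∈ Set.Ioo (0 : ℝ) 1) (hna : num a = 0) :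
    StrictMonoOn (fun y => f y / (1 - y ^ 2)) (Set.Icc 0 a) := by
  refine strictMonoOn_of_deriv_pos (convex_Icc 0 a)
    (continuousOn_quotient.mono fun x hx => ⟨hx.1, hx.2.trans_lt ha.2⟩) fun x hx => ?_
  rw [interior_Icc] at hx
  have h1 := hx.2.trans ha.2
  rw [(hasDerivAt_quotient hx.1 h1).deriv]
  have h : 0 < 1 - x ^ 2 := by nlinarith [hx.1]
  exact div_pos (num_pos_of_lt ha hna hx.1 hx.2) (by positivity)

theorem strictAntiOn_quotient (ha : a ∈ Set.Ioo (0 : ℝ) 1) (hna : num a = 0) :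
    StrictAntiOn (fun y => f y / (1 - y ^ 2)) (Set.Ico a 1) := by
  refine strictAntiOn_of_deriv_neg (convex_Ico a 1)
    (continuousOn_quotient.mono fun x hx => ⟨ha.1.le.trans hx.1, hx.2⟩) fun x hx => ?_
  rw [interior_Ico] at hx
  have h0 := ha.1.trans hx.1
  rw [(hasDerivAt_quotient h0 hx.2).deriv]
  have h : 0 < 1 - x ^ 2 := by nlinarith [hx.2]
  exact div_neg_of_neg_of_pos (num_neg_of_gt ha hna hx.2 hx.1) (by positivity)

theorem quotient_le (ha : a ∈ Set.Ioo (0 : ℝ) 1) (hna : num a = 0) {x : ℝ}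
    (hx : x ∈ Set.Ico (0 : ℝ) 1) : f x / (1 - x ^ 2) ≤ f a / (1 - a ^ 2) := by
  rcases le_total x a with h | h
  · exact (strictMonoOn_quotient ha hna).monotoneOn ⟨hx.1, h⟩ ⟨ha.1.le, le_rfl⟩ h
  · exact (strictAntiOn_quotient ha hna).antitoneOn ⟨le_rfl, ha.2⟩ ⟨h, hx.2⟩ h

theorem quotient_pos (ha : a ∈ Set.Ioo (0 : ℝ) 1) (hna : num a = 0) :
    0 < f a / (1 - a ^ 2) := by
  have := strictMonoOn_quotient ha hna ⟨le_rfl, ha.1.le⟩ ⟨ha.1.le, le_rfl⟩ ha.1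
  simpa [f] using this

/-- The two equations say that `γ` is a critical value of `f x / (1 - x ^ 2)`. -/
theorem system_iff (ha : a ∈ Set.Ioo (0 : ℝ) 1) (γ : ℝ) :
    (2 * γ * a + deriv f a = 0 ∧ γ * a ^ 2 + f a = γ) ↔
      num a = 0 ∧ γ = f a / (1 - a ^ 2) := by
  have h : 1 - a ^ 2 ≠ 0 := by nlinarith [ha.1, ha.2]
  rw [(hasDerivAt_f ha.1 ha.2).deriv, eq_div_iff h, num]
  constructor
  · rintro ⟨h1, h2⟩
    exact ⟨by linear_combination (1 - a ^ 2) * h1 + 2 * a * h2, by linear_combination -h2⟩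
  · rintro ⟨h1, h2⟩
    refine ⟨mul_right_cancel₀ h ?_, by linear_combination -h2⟩
    linear_combination h1 + 2 * a * h2

end CriticalPoint

end MaxQuadratic

open MaxQuadratic in
/-- There exist a unique `γ > 0` and a unique `α ∈ (0,1)` with
(1) `2γα + f′(α) = 0` and (2) `γα² + f(α) = γ`; moreover for this `γ` the maximum of
`f(x) + γx²` over `x ∈ [0,1)` equals `γ` and is attained at `x = α`. -/
theorem max_of_f_plus_quadratic :
    (∃! q : ℝ × ℝ, 0 < q.1 ∧ q.2 ∈ Set.Ioo (0 : ℝ) 1 ∧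
        2 * q.1 * q.2 + deriv f q.2 = 0 ∧ q.1 * q.2 ^ 2 + f q.2 = q.1) ∧
      ∀ γ α : ℝ, 0 < γ → α ∈ Set.Ioo (0 : ℝ) 1 →
        2 * γ * α + deriv f α = 0 → γ * α ^ 2 + f α = γ →
          (∀ x ∈ Set.Ico (0 : ℝ) 1, f x + γ * x ^ 2 ≤ γ) ∧ f α + γ * α ^ 2 = γ := by
  constructor
  · obtain ⟨a, ha0, hah, hna⟩ := exists_num_eq_zero (x := 1 / 2) (by norm_num) num_half_neg.le
    have ha : a ∈ Set.Ioo (0 : ℝ) 1 := ⟨ha0, by linarith⟩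
    refine ⟨(f a / (1 - a ^ 2), a),
      ⟨quotient_pos ha hna, ha, (system_iff ha _).2 ⟨hna, rfl⟩⟩, ?_⟩
    rintro ⟨γ, b⟩ ⟨-, hb, hs⟩
    obtain ⟨hnb, hγ⟩ := (system_iff hb γ).1 hs
    have hab : a = b := num_zero_unique ha hb hna hnb
    subst hab
    exact Prod.ext hγ rfl
  · intro γ α _ hα h1 h2
    obtain ⟨hn, hγ⟩ := (system_iff hα γ).1 ⟨h1, h2⟩
    refine ⟨fun x hx => ?_, by linarith⟩
    have h : 0 < 1 - x ^ 2 := by nlinarith [hx.1, hx.2]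
    have hle := quotient_le hα hn hx
    rw [← hγ, div_le_iff₀ h] at hle
    linarith
end

section
/- The function f satisfies f(x) > 0 for all x ∈ (0,1), and f(x) → 0 as x → 0⁺ and f(x) → 0 as x → 1⁻. -/
theorem continuous_f : Continuous f := by
  have h := Real.continuous_mul_log
  have h₁ : Continuous fun x : ℝ => (1 - x) * Real.log (1 - x) := h.comp (by fun_prop)
  have h₂ : Continuous fun x : ℝ => (1 + x) * Real.log (1 + x) := h.comp (by fun_prop)
  have key : f = fun x : ℝ => x * (x * Real.log x)
      - (1 / 2) * (1 - x) * ((1 - x) * Real.log (1 - x))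
      - (1 / 2) * (1 + x) * ((1 + x) * Real.log (1 + x)) + 2 * x * Real.log 2 := by
    funext x
    unfold f
    ring
  rw [key]
  fun_prop

theorem f_zero : f 0 = 0 := by simp [f]

theorem f_one : f 1 = 0 := by
  norm_num [f]

/-- The derivative of `f` on `(0,1)`, extended continuously to `ℝ`. -/
noncomputable def fDeriv (x : ℝ) : ℝ :=
  2 * (x * Real.log x) + (1 - x) * Real.log (1 - x) - (1 + x) * Real.log (1 + x)
    + 2 * Real.log 2

theorem continuous_fDeriv : Continuous fDeriv := by
  have h := Real.continuous_mul_log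
  have h₁ : Continuous fun x : ℝ => (1 - x) * Real.log (1 - x) := h.comp (by fun_prop)
  have h₂ : Continuous fun x : ℝ => (1 + x) * Real.log (1 + x) := h.comp (by fun_prop)
  unfold fDeriv
  fun_prop

theorem fDeriv_one : fDeriv 1 = 0 := by
  norm_num [fDeriv]

theorem hasDerivAt_f {x : ℝ} (hx : x ∈ Set.Ioo (0 : ℝ) 1) : HasDerivAt f (fDeriv x) x := by
  obtain ⟨h0, h1⟩ := hx
  have e1 : 1 - x ≠ 0 := by linarith
  have e2 : 1 + x ≠ 0 := by linarith
  have i := hasDerivAt_id' x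
  have a := i.const_sub 1
  have b := i.const_add 1
  have h := ((((i.pow 2).mul (i.log h0.ne')).sub (((a.pow 2).const_mul (1 / 2)).mul (a.log e1))).sub
    (((b.pow 2).const_mul (1 / 2)).mul (b.log e2))).add ((i.const_mul 2).mul_const (Real.log 2))
  refine h.congr_deriv ?_
  simp only [fDeriv, Pi.pow_apply]
  field_simp
  ring

theorem hasDerivAt_fDeriv {x : ℝ} (hx : x ∈ Set.Ioo (0 : ℝ) 1) :
    HasDerivAt fDeriv (Real.log (x ^ 2) - Real.log (1 - x ^ 2)) x := by
  obtain ⟨h0, h1⟩ := hx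
  have e1 : 1 - x ≠ 0 := by linarith
  have e2 : 1 + x ≠ 0 := by linarith
  have i := hasDerivAt_id' x
  have a := i.const_sub 1
  have b := i.const_add 1
  have h := ((((i.mul (i.log h0.ne')).const_mul 2).add (a.mul (a.log e1))).sub
    (b.mul (b.log e2))).add_const (2 * Real.log 2)
  refine h.congr_deriv ?_
  rw [show 1 - x ^ 2 = (1 - x) * (1 + x) by ring, Real.log_mul e1 e2, Real.log_pow]
  field_simp
  push_cast
  ring

theorem f_pos_right {c x : ℝ} (hc : 0 < c) (hc2 : c ^ 2 = 1 / 2) (hx : x ∈ Set.Ico c 1) :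
    0 < f x := by
  have hmono : StrictMonoOn fDeriv (Set.Icc c 1) := by
    refine strictMonoOn_of_hasDerivWithinAt_pos (convex_Icc c 1) continuous_fDeriv.continuousOn
      (f' := fun y => Real.log (y ^ 2) - Real.log (1 - y ^ 2)) ?_ ?_ <;>
      rw [interior_Icc] <;> rintro y ⟨hy, hy1⟩
    · exact (hasDerivAt_fDeriv ⟨hc.trans hy, hy1⟩).hasDerivWithinAt
    · exact sub_pos.2 (Real.log_lt_log (by nlinarith) (by nlinarith))
  have hanti : StrictAntiOn f (Set.Icc c 1) := by
    refine strictAntiOn_of_hasDerivWithinAt_neg (convex_Icc c 1) continuous_f.continuousOn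
      (f' := fDeriv) ?_ ?_ <;>
      rw [interior_Icc] <;> rintro y ⟨hy, hy1⟩
    · exact (hasDerivAt_f ⟨hc.trans hy, hy1⟩).hasDerivWithinAt
    · rw [← fDeriv_one]
      exact hmono ⟨hy.le, hy1.le⟩ ⟨(hy.trans hy1).le, le_rfl⟩ hy1
  rw [← f_one]
  exact hanti ⟨hx.1, hx.2.le⟩ ⟨hx.1.trans hx.2.le, le_rfl⟩ hx.2

theorem concaveOn_f {c : ℝ} (hc : 0 < c) (hc2 : c ^ 2 = 1 / 2) :
    ConcaveOn ℝ (Set.Icc 0 c) f := by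
  have hc1 : c < 1 := by nlinarith
  refine concaveOn_of_hasDerivWithinAt2_nonpos (convex_Icc 0 c) continuous_f.continuousOn
    (f' := fDeriv) (f'' := fun y => Real.log (y ^ 2) - Real.log (1 - y ^ 2)) ?_ ?_ ?_ <;>
    rw [interior_Icc] <;> rintro y ⟨hy, hy1⟩
  · exact (hasDerivAt_f ⟨hy, hy1.trans hc1⟩).hasDerivWithinAt
  · exact (hasDerivAt_fDeriv ⟨hy, hy1.trans hc1⟩).hasDerivWithinAt
  · exact sub_nonpos.2 (Real.log_le_log (by positivity) (by nlinarith))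

theorem f_pos {x : ℝ} (hx : x ∈ Set.Ioo (0 : ℝ) 1) : 0 < f x := by
  obtain ⟨c, hc, hc2⟩ : ∃ c : ℝ, 0 < c ∧ c ^ 2 = 1 / 2 :=
    ⟨√(1 / 2), by positivity, Real.sq_sqrt (by norm_num)⟩
  have hc1 : c < 1 := by nlinarith
  rcases le_or_gt c x with h | h
  · exact f_pos_right hc hc2 ⟨h, hx.2⟩
  · have hfc := f_pos_right hc hc2 ⟨le_rfl, hc1⟩
    have hxc : x / c ≤ 1 := (div_le_one hc).2 h.le
    have hpos : 0 < x / c := div_pos hx.1 hc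
    have key := (concaveOn_f hc hc2).2 (Set.left_mem_Icc.2 hc.le) (Set.right_mem_Icc.2 hc.le)
      (sub_nonneg.2 hxc) hpos.le (by ring)
    simp only [smul_eq_mul, f_zero, mul_zero, zero_add, div_mul_cancel₀ x hc.ne'] at key
    exact (mul_pos hpos hfc).trans_le key

/-- `f(x) > 0` on `(0,1)`, and `f(x) → 0` as `x → 0⁺` and as `x → 1⁻`. -/
theorem f_pos_and_limits :
    (∀ x ∈ Set.Ioo (0 : ℝ) 1, 0 < f x) ∧
      Filter.Tendsto f (nhdsWithin 0 (Set.Ioi (0 : ℝ))) (nhds 0) ∧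
      Filter.Tendsto f (nhdsWithin 1 (Set.Iio (1 : ℝ))) (nhds 0) := by
  refine ⟨fun x hx => f_pos hx, ?_, ?_⟩
  · simpa only [f_zero] using (continuous_f.tendsto 0).mono_left nhdsWithin_le_nhds
  · simpa only [f_one] using (continuous_f.tendsto 1).mono_left nhdsWithin_le_nhds
end

section
/- Let p ≥ 1 and m ≥ 0 be integers, let w₀(p) = (p, p−1, …, 1) be the longest permutation in S_p, and let 1^m × w₀(p) ∈ S_{m+p} be the permutation fixing 1,…,m and mapping m+i to m+p+1−i for 1 ≤ i ≤ p. Then Υ_{1^m × w₀(p)} = Π_{1 ≤ i < j ≤ p} (2m+i+j−1)/(i+j−1). -/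
/-- Reversal of the block of positions `s+1, …, s+c`, as a permutation of `ℕ`. -/
def blockRev (s c : ℕ) : Equiv.Perm ℕ :=
  ((List.range (c / 2)).map fun i => Equiv.swap (s + i + 1) (s + c - i)).prod

/-- `F(m,p) = ∏_{1 ≤ i < j ≤ p} (2m + i + j − 1)/(i + j − 1)` (empty product is `1`). -/
noncomputable def F (m p : ℕ) : ℝ :=
  ∏ i ∈ Finset.Icc 1 p, ∏ j ∈ Finset.Ioc i p,
    (2 * (m : ℝ) + i + j - 1) / ((i : ℝ) + j - 1)

namespace Macdonald

section Words

/-! ### Reduced words -/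

/-- The permutation of a word that is stored with its last letter first. -/
def wordPerm : List ℕ → Equiv.Perm ℕ
  | [] => 1
  | i :: l => wordPerm l * sT i

/-- A word, stored with its last letter first, all of whose steps create an inversion. -/
def IsRed : List ℕ → Prop
  | [] => True
  | i :: l => IsRed l ∧ wordPerm l i < wordPerm l (i + 1)

/-- The evaluation of a word, stored with its last letter first, in a monoid. -/
def wordEval {M : Type*} [Monoid M] (d : ℕ → M) : List ℕ → M
  | [] => 1
  | i :: l => wordEval d l * d i

/-- All letters are indices of simple transpositions of `{1, …, n}`. -/
def IsWord (n : ℕ) (l : List ℕ) : Prop := ∀ i ∈ l, 1 ≤ i ∧ i < n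

lemma isWord_cons {n i : ℕ} {l : List ℕ} :
    IsWord n (i :: l) ↔ (1 ≤ i ∧ i < n) ∧ IsWord n l := by
  simp [IsWord]

lemma sT_left (i : ℕ) : sT i i = i + 1 := Equiv.swap_apply_left _ _

lemma sT_right (i : ℕ) : sT i (i + 1) = i := Equiv.swap_apply_right _ _

lemma sT_of_ne {i x : ℕ} (h : x ≠ i) (h' : x ≠ i + 1) : sT i x = x :=
  Equiv.swap_apply_of_ne_of_ne h h'

lemma sT_apply (i x : ℕ) : sT i x = if x = i then i + 1 else if x = i + 1 then i else x :=
  Equiv.swap_apply_def _ _ _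

lemma sT_mul_self (i : ℕ) : sT i * sT i = 1 := Equiv.swap_mul_self _ _

lemma sT_sT (i x : ℕ) : sT i (sT i x) = x := by
  rw [← Equiv.Perm.mul_apply, sT_mul_self, Equiv.Perm.one_apply]

lemma sT_comm {i j : ℕ} (h : i + 2 ≤ j) : sT i * sT j = sT j * sT i := by
  ext x
  simp only [Equiv.Perm.mul_apply, sT_apply]
  split_ifs <;> omega

lemma sT_braid (i : ℕ) : sT i * sT (i + 1) * sT i = sT (i + 1) * sT i * sT (i + 1) := by
  ext x
  simp only [Equiv.Perm.mul_apply, sT_apply]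
  split_ifs <;> omega

lemma mem_inversions {n a b : ℕ} {w : Equiv.Perm ℕ} :
    (a, b) ∈ (Finset.Icc 1 n ×ˢ Finset.Icc 1 n).filter (fun p => p.1 < p.2 ∧ w p.2 < w p.1) ↔
      (((1 ≤ a ∧ a ≤ n) ∧ 1 ≤ b ∧ b ≤ n) ∧ a < b) ∧ w b < w a := by
  simp only [Finset.mem_filter, Finset.mem_product, Finset.mem_Icc, and_assoc]

lemma len_mul_sT {n i : ℕ} (w : Equiv.Perm ℕ) (hi : 1 ≤ i) (hin : i < n)
    (hw : w i < w (i + 1)) : len n (w * sT i) = len n w + 1 := by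
  unfold len
  set S := (Finset.Icc 1 n ×ˢ Finset.Icc 1 n).filter (fun p => p.1 < p.2 ∧ w p.2 < w p.1)
  set S' := (Finset.Icc 1 n ×ˢ Finset.Icc 1 n).filter
    (fun p => p.1 < p.2 ∧ (w * sT i) p.2 < (w * sT i) p.1)
  have hS' : S' = insert (i, i + 1) (S.map ((sT i).prodCongr (sT i)).toEmbedding) := by
    ext ⟨a, b⟩
    rw [Finset.mem_insert, Finset.mem_map_equiv]
    have hsymm : ((sT i).prodCongr (sT i)).symm (a, b) = (sT i a, sT i b) := by
      simp [sT]
    rw [hsymm, mem_inversions, mem_inversions, Equiv.Perm.mul_apply, Equiv.Perm.mul_apply]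
    by_cases hab : a = i ∧ b = i + 1
    · obtain ⟨rfl, rfl⟩ := hab
      simp only [sT_left, sT_right, true_or, iff_true]
      exact ⟨⟨⟨⟨hi, by omega⟩, by omega, by omega⟩, by omega⟩, hw⟩
    · by_cases hba : b = i ∧ a = i + 1
      · obtain ⟨rfl, rfl⟩ := hba
        simp only [sT_left, sT_right, Prod.mk.injEq]
        constructor
        · rintro ⟨⟨-, h⟩, -⟩
          omega
        · rintro (h | ⟨-, h⟩) <;> omega
      · have key : ((1 ≤ a ∧ a ≤ n) ∧ 1 ≤ b ∧ b ≤ n) ∧ a < b ↔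
            ((1 ≤ sT i a ∧ sT i a ≤ n) ∧ 1 ≤ sT i b ∧ sT i b ≤ n) ∧ sT i a < sT i b := by
          simp only [sT_apply]
          split_ifs <;> omega
        have hne : (a, b) ≠ (i, i + 1) := by simpa using hab
        rw [key, or_iff_right hne]
  rw [hS', Finset.card_insert_of_notMem, Finset.card_map]
  rw [Finset.mem_map_equiv]
  have hsymm : ((sT i).prodCongr (sT i)).symm (i, i + 1) = (i + 1, i) := by
    simp [sT]
  rw [hsymm, mem_inversions]
  omega

lemma len_one (n : ℕ) : len n 1 = 0 := by
  rw [len, Finset.card_eq_zero, Finset.filter_eq_empty_iff]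
  intro x _
  simp only [Equiv.Perm.one_apply]
  omega

lemma len_wordPerm {n : ℕ} {l : List ℕ} (hl : IsWord n l) (hr : IsRed l) :
    len n (wordPerm l) = l.length := by
  induction l with
  | nil => exact len_one n
  | cons i l ih =>
    rw [isWord_cons] at hl
    rw [wordPerm, len_mul_sT _ hl.1.1 hl.1.2 hr.2, ih hl.2 hr.1, List.length_cons]

/-- `w` only moves points of `{1, …, n}`. -/
def FixesOutside (n : ℕ) (w : Equiv.Perm ℕ) : Prop := ∀ x, x < 1 ∨ n < x → w x = x

lemma FixesOutside.mul_sT {n i : ℕ} {w : Equiv.Perm ℕ} (hw : FixesOutside n w)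
    (hi : 1 ≤ i) (hin : i < n) : FixesOutside n (w * sT i) := by
  intro x hx
  rw [Equiv.Perm.mul_apply, sT_of_ne (by omega) (by omega), hw x hx]

lemma fixesOutside_wordPerm {n : ℕ} {l : List ℕ} (hl : IsWord n l) :
    FixesOutside n (wordPerm l) := by
  induction l with
  | nil => intro x _; rfl
  | cons i l ih =>
    rw [isWord_cons] at hl
    exact (ih hl.2).mul_sT hl.1.1 hl.1.2

lemma eq_one_of_lt_succ {w : Equiv.Perm ℕ} (h : ∀ i, w i < w (i + 1)) : w = 1 := by
  have hm : StrictMono w := strictMono_nat_of_lt_succ h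
  have hm' : StrictMono (w⁻¹ : Equiv.Perm ℕ) := fun a b hab => by
    rw [← hm.lt_iff_lt]
    simpa using hab
  ext x
  refine le_antisymm ?_ (hm.le_apply)
  have := hm'.le_apply (x := w x)
  simpa using this

lemma FixesOutside.lt_succ {n i : ℕ} {w : Equiv.Perm ℕ} (hw : FixesOutside n w)
    (h : ¬ (1 ≤ i ∧ i < n)) : w i < w (i + 1) := by
  rcases Nat.lt_or_ge i 1 with hi | hi
  · rw [hw i (Or.inl hi)]
    have : w (i + 1) ≠ w i := w.injective.ne (by omega)
    rw [hw i (Or.inl hi)] at this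
    omega
  · rw [hw (i + 1) (Or.inr (by omega))]
    by_contra hlt
    have h1 : w (w i) = w i := hw _ (by omega)
    have h2 := w.injective h1
    omega

lemma exists_red {n : ℕ} {w : Equiv.Perm ℕ} (hw : FixesOutside n w) :
    ∃ l, IsWord n l ∧ IsRed l ∧ wordPerm l = w := by
  induction hk : len n w using Nat.strong_induction_on generalizing w with
  | _ k ih =>
    by_cases h : ∀ i, w i < w (i + 1)
    · exact ⟨[], by simp [IsWord], trivial, (eq_one_of_lt_succ h).symm⟩
    · push Not at h
      obtain ⟨i, hi⟩ := h
      have hne : w (i + 1) ≠ w i := w.injective.ne (by omega)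
      have hin : 1 ≤ i ∧ i < n := by
        by_contra hc
        have := hw.lt_succ hc
        omega
      have hasc : (w * sT i) i < (w * sT i) (i + 1) := by
        simp only [Equiv.Perm.mul_apply, sT_left, sT_right]
        omega
      have hww : w * sT i * sT i = w := by rw [mul_assoc, sT_mul_self, mul_one]
      have hlen := len_mul_sT (n := n) (w * sT i) hin.1 hin.2 hasc
      rw [hww] at hlen
      obtain ⟨l, hl, hr, he⟩ := ih _ (by omega) (hw.mul_sT hin.1 hin.2) rfl
      exact ⟨i :: l, isWord_cons.2 ⟨hin, hl⟩, ⟨hr, he ▸ hasc⟩, by rw [wordPerm, he, hww]⟩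

lemma IsRed.descent {i : ℕ} {l : List ℕ} (h : IsRed (i :: l)) :
    wordPerm (i :: l) (i + 1) < wordPerm (i :: l) i := by
  simpa only [wordPerm, Equiv.Perm.mul_apply, sT_left, sT_right] using h.2

lemma wordPerm_cons_mul (i : ℕ) (l : List ℕ) : wordPerm (i :: l) * sT i = wordPerm l := by
  rw [wordPerm, mul_assoc, sT_mul_self, mul_one]

section Eval

variable {M : Type*} [MonoidWithZero M] {d : ℕ → M}

/-- Matsumoto's theorem: the value of a reduced word depends only on its permutation. -/
lemma wordEval_eq_of_isRed (hcomm : ∀ i j, i + 2 ≤ j → d i * d j = d j * d i)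
    (hbraid : ∀ i, d i * d (i + 1) * d i = d (i + 1) * d i * d (i + 1)) {n : ℕ}
    {l l' : List ℕ} (hl : IsWord n l) (hl' : IsWord n l') (hr : IsRed l) (hr' : IsRed l')
    (h : wordPerm l = wordPerm l') : wordEval d l = wordEval d l' := by
  induction hk : l.length using Nat.strong_induction_on generalizing l l' with
  | _ k ih =>
    have hlen : l.length = l'.length := by
      rw [← len_wordPerm hl hr, ← len_wordPerm hl' hr', h]
    match l, l' with
    | [], [] => rfl
    | [], j :: b => simp at hlen
    | i :: a, [] => simp at hlen
    | i :: a, j :: b =>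
      simp only [List.length_cons, Nat.add_right_cancel_iff] at hlen hk
      rcases eq_or_ne i j with rfl | hij
      · have hab : wordPerm a = wordPerm b := by
          rw [← wordPerm_cons_mul i a, h, wordPerm_cons_mul]
        rw [isWord_cons] at hl hl'
        rw [wordEval, wordEval, ih a.length (by omega) hl.2 hl'.2 hr.1 hr'.1 hab rfl]
      · wlog hlt : i < j generalizing i a j b
        · exact (this j b i a hl' hl hr' hr h.symm (by omega) (by omega) hij.symm
            (by omega)).symm
        have hdi := hr.descent
        have hdj := hr'.descent
        rw [← h] at hdj
        have hfix := fixesOutside_wordPerm hl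
        have hwa := wordPerm_cons_mul i a
        have hwb := wordPerm_cons_mul j b
        rw [← h] at hwb
        set w := wordPerm (i :: a) with hw
        rw [isWord_cons] at hl hl'
        rcases Nat.lt_or_ge (i + 1) j with hj | hj
        · obtain ⟨c, hc, hrc, hec⟩ := exists_red
            ((hfix.mul_sT hl.1.1 hl.1.2).mul_sT hl'.1.1 hl'.1.2)
          have hca : wordPerm (j :: c) = wordPerm a := by
            rw [wordPerm, hec, mul_assoc, sT_mul_self, mul_one, hwa]
          have hcb : wordPerm (i :: c) = wordPerm b := by
            rw [wordPerm, hec, mul_assoc w, sT_comm (by omega), ← mul_assoc, mul_assoc,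
              sT_mul_self, mul_one, hwb]
          have hrca : IsRed (j :: c) := by
            refine ⟨hrc, ?_⟩
            rw [hec]
            simp only [Equiv.Perm.mul_apply, sT_left, sT_right]
            rwa [sT_of_ne (i := i) (x := j) (by omega) (by omega),
              sT_of_ne (i := i) (x := j + 1) (by omega) (by omega)]
          have hrcb : IsRed (i :: c) := by
            refine ⟨hrc, ?_⟩
            rw [hec]
            simp only [Equiv.Perm.mul_apply]
            rwa [sT_of_ne (i := j) (x := i) (by omega) (by omega),
              sT_of_ne (i := j) (x := i + 1) (by omega) (by omega), sT_left, sT_right]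
          rw [wordEval, wordEval,
            ih a.length (by omega) hl.2 (isWord_cons.2 ⟨hl'.1, hc⟩) hr.1 hrca hca.symm rfl,
            ih b.length (by omega) hl'.2 (isWord_cons.2 ⟨hl.1, hc⟩) hr'.1 hrcb hcb.symm rfl,
            wordEval, wordEval, mul_assoc, mul_assoc, hcomm i j (by omega)]
        · obtain rfl : j = i + 1 := by omega
          obtain ⟨c, hc, hrc, hec⟩ := exists_red
            (((hfix.mul_sT hl.1.1 hl.1.2).mul_sT hl'.1.1 hl'.1.2).mul_sT hl.1.1 hl.1.2)
          have hca : wordPerm ((i + 1) :: i :: c) = wordPerm a := by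
            rw [wordPerm, wordPerm, hec, mul_assoc _ (sT i) (sT i), sT_mul_self, mul_one,
              mul_assoc _ (sT (i + 1)), sT_mul_self, mul_one, hwa]
          have hcb : wordPerm (i :: (i + 1) :: c) = wordPerm b := by
            have e : sT i * sT (i + 1) * sT i * sT (i + 1) * sT i = sT (i + 1) := by
              rw [sT_braid, mul_assoc _ (sT (i + 1)) (sT (i + 1)), sT_mul_self, mul_one,
                mul_assoc, sT_mul_self, mul_one]
            rw [wordPerm, wordPerm, hec, ← hwb]
            conv_rhs => rw [← e]
            simp only [mul_assoc]
          have e0 : sT (i + 1) i = i := sT_of_ne (by omega) (by omega)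
          have e1 : sT (i + 1) (i + 1) = i + 2 := sT_left _
          have e2 : sT (i + 1) (i + 2) = i + 1 := sT_right _
          have e3 : sT i (i + 2) = i + 2 := sT_of_ne (by omega) (by omega)
          have e4 := sT_left i
          have e5 := sT_right i
          have hrca : IsRed ((i + 1) :: i :: c) := by
            refine ⟨⟨hrc, ?_⟩, ?_⟩ <;>
            simp only [wordPerm, hec, Equiv.Perm.mul_apply, e0, e1, e2, e3, e4, e5,
              show i + 1 + 1 = i + 2 from rfl] at hdj ⊢ <;> omega
          have hrcb : IsRed (i :: (i + 1) :: c) := by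
            refine ⟨⟨hrc, ?_⟩, ?_⟩ <;>
            simp only [wordPerm, hec, Equiv.Perm.mul_apply, e0, e1, e2, e3, e4, e5,
              show i + 1 + 1 = i + 2 from rfl] at hdj ⊢ <;> omega
          rw [wordEval, wordEval,
            ih a.length (by omega) hl.2
              (isWord_cons.2 ⟨hl'.1, isWord_cons.2 ⟨hl.1, hc⟩⟩) hr.1 hrca hca.symm rfl,
            ih b.length (by omega) hl'.2
              (isWord_cons.2 ⟨hl.1, isWord_cons.2 ⟨hl'.1, hc⟩⟩) hr'.1 hrcb hcb.symm rfl,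
            wordEval, wordEval, wordEval, wordEval, mul_assoc, mul_assoc, mul_assoc, mul_assoc,
            ← mul_assoc (d i), hbraid, mul_assoc]

lemma len_mul_sT_of_gt {n i : ℕ} (w : Equiv.Perm ℕ) (hi : 1 ≤ i) (hin : i < n)
    (hw : w (i + 1) < w i) : len n w = len n (w * sT i) + 1 := by
  have := len_mul_sT (n := n) (w * sT i) hi hin
    (by simpa only [Equiv.Perm.mul_apply, sT_left, sT_right] using hw)
  rwa [mul_assoc, sT_mul_self, mul_one] at this

/-- Words that are not reduced evaluate to zero. -/
lemma isRed_or_wordEval_eq_zero (hsq : ∀ i, d i * d i = 0)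
    (hcomm : ∀ i j, i + 2 ≤ j → d i * d j = d j * d i)
    (hbraid : ∀ i, d i * d (i + 1) * d i = d (i + 1) * d i * d (i + 1)) {n : ℕ}
    {l : List ℕ} (hl : IsWord n l) :
    IsRed l ∨ (len n (wordPerm l) < l.length ∧ wordEval d l = 0) := by
  induction l with
  | nil => exact Or.inl trivial
  | cons i l ih =>
    rw [isWord_cons] at hl
    have hne : wordPerm l i ≠ wordPerm l (i + 1) := (wordPerm l).injective.ne (by omega)
    rcases ih hl.2 with hr | ⟨hlt, h0⟩
    · rcases lt_or_gt_of_ne hne with h | h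
      · exact Or.inl ⟨hr, h⟩
      · right
        have h1 := len_mul_sT_of_gt _ hl.1.1 hl.1.2 h
        have h2 := len_wordPerm hl.2 hr
        refine ⟨by rw [wordPerm, List.length_cons]; omega, ?_⟩
        obtain ⟨c, hc, hrc, hec⟩ := exists_red
          ((fixesOutside_wordPerm hl.2).mul_sT hl.1.1 hl.1.2)
        have he : wordPerm (i :: c) = wordPerm l := by
          rw [wordPerm, hec, mul_assoc, sT_mul_self, mul_one]
        have hri : IsRed (i :: c) := by
          refine ⟨hrc, ?_⟩
          rw [hec]
          simpa only [Equiv.Perm.mul_apply, sT_left, sT_right] using h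
        rw [wordEval, wordEval_eq_of_isRed hcomm hbraid hl.2 (isWord_cons.2 ⟨hl.1, hc⟩) hr hri
          he.symm, wordEval, mul_assoc, hsq, mul_zero]
    · right
      refine ⟨?_, by rw [wordEval, h0, zero_mul]⟩
      rw [wordPerm, List.length_cons]
      rcases lt_or_gt_of_ne hne with h | h
      · rw [len_mul_sT _ hl.1.1 hl.1.2 h]; omega
      · have := len_mul_sT_of_gt _ hl.1.1 hl.1.2 h
        omega

end Eval

end Words

section BlockReversal

/-! ### The block reversal -/

lemma blockRev_apply (m p x : ℕ) :
    blockRev m p x = if m < x ∧ x ≤ m + p then 2 * m + p + 1 - x else x := by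
  have key : ∀ k, 2 * k ≤ p → ∀ x,
      ((List.range k).map fun i => Equiv.swap (m + i + 1) (m + p - i)).prod x =
        if (m < x ∧ x ≤ m + k) ∨ (m + p - k < x ∧ x ≤ m + p) then 2 * m + p + 1 - x else x := by
    intro k
    induction k with
    | zero =>
      intro _ x
      rw [if_neg (by omega)]
      rfl
    | succ k ih =>
      intro hk x
      rw [List.range_succ, List.map_append, List.prod_append, List.map_singleton,
        List.prod_singleton, Equiv.Perm.mul_apply, ih (by omega), Equiv.swap_apply_def]
      split_ifs <;> omega
  rw [blockRev, key _ (by omega)]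
  split_ifs <;> omega

lemma blockRev_mul_self (m p : ℕ) : blockRev m p * blockRev m p = 1 := by
  ext x
  simp only [Equiv.Perm.mul_apply, blockRev_apply, Equiv.Perm.one_apply]
  split_ifs <;> omega

/-- The block reversal is the unique permutation of its block with that many inversions. -/
lemma eq_blockRev_of_le_len {m p : ℕ} {w : Equiv.Perm ℕ}
    (hw : ∀ x, x ≤ m ∨ m + p < x → w x = x)
    (hlen : ∑ j ∈ Finset.range p, j ≤ len (m + p) w) : w = blockRev m p := by
  have hmaps : ∀ x, m < x → x ≤ m + p → m < w x ∧ w x ≤ m + p := by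
    intro x h1 h2
    by_contra hc
    have h3 : w (w x) = w x := hw _ (by omega)
    have h4 := w.injective h3
    omega
  set I := (Finset.Icc 1 (m + p) ×ˢ Finset.Icc 1 (m + p)).filter
    (fun q => q.1 < q.2 ∧ w q.2 < w q.1) with hI
  set T := (Finset.range p).biUnion fun j => (Finset.range j).image
    fun i => (m + i + 1, m + j + 1) with hT
  have hmemT : ∀ a b, (a, b) ∈ T ↔ m < a ∧ a < b ∧ b ≤ m + p := by
    intro a b
    simp only [hT, Finset.mem_biUnion, Finset.mem_image, Finset.mem_range, Prod.mk.injEq]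
    constructor
    · rintro ⟨j, hj, i, hi, rfl, rfl⟩
      omega
    · rintro ⟨h1, h2, h3⟩
      exact ⟨b - m - 1, by omega, a - m - 1, by omega, by omega, by omega⟩
  have hIT : I ⊆ T := by
    rintro ⟨a, b⟩ h
    rw [hI, mem_inversions] at h
    rw [hmemT]
    refine ⟨?_, by omega, by omega⟩
    by_contra hc
    have h1 : w a = a := hw a (by omega)
    rcases Nat.lt_or_ge m b with hb | hb
    · have := hmaps b hb (by omega)
      omega
    · have : w b = b := hw b (by omega)
      omega
  have hcard : T.card ≤ ∑ j ∈ Finset.range p, j := by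
    refine Finset.card_biUnion_le.trans (Finset.sum_le_sum fun j _ => ?_)
    exact Finset.card_image_le.trans (Finset.card_range j).le
  have hEq : I = T := Finset.eq_of_subset_of_card_le hIT (hcard.trans hlen)
  have hanti : ∀ a b, m < a → a < b → b ≤ m + p → w b < w a := by
    intro a b h1 h2 h3
    have h : (a, b) ∈ I := hEq ▸ (hmemT a b).2 ⟨h1, h2, h3⟩
    rw [hI, mem_inversions] at h
    exact h.2
  have hone : w * blockRev m p = 1 := by
    refine eq_one_of_lt_succ fun i => ?_
    simp only [Equiv.Perm.mul_apply, blockRev_apply]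
    split_ifs with h1 h2 h2
    · exact hanti _ _ (by omega) (by omega) (by omega)
    · have := hmaps (2 * m + p + 1 - i) (by omega) (by omega)
      rw [hw (i + 1) (by omega)]
      omega
    · have := hmaps (2 * m + p + 1 - (i + 1)) (by omega) (by omega)
      rw [hw i (by omega)]
      omega
    · rw [hw i (by omega), hw (i + 1) (by omega)]
      omega
  rw [← mul_one w, ← blockRev_mul_self m p, ← mul_assoc, hone, one_mul]

/-! ### A product formula for a binomial determinant -/

/-- Determinants of polynomials evaluated at nodes scale like Vandermonde determinants. -/
lemma det_eval_mul_det_vandermonde {R : Type*} [CommRing R] {N : ℕ}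
    (q : Fin N → Polynomial R) (hq : ∀ j, (q j).natDegree < N) (v v' : Fin N → R) :
    (Matrix.of fun i j => (q j).eval (v i)).det * (Matrix.vandermonde v').det =
      (Matrix.of fun i j => (q j).eval (v' i)).det * (Matrix.vandermonde v).det := by
  have key : ∀ u : Fin N → R, (Matrix.of fun i j => (q j).eval (u i)) =
      Matrix.vandermonde u * Matrix.of fun k j : Fin N => (q j).coeff k := by
    intro u
    ext i j
    rw [Matrix.of_apply, Matrix.mul_apply, Polynomial.eval_eq_sum_range' (hq j),
      ← Fin.sum_univ_eq_sum_range (fun k => (q j).coeff k * u i ^ k)]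
    exact Finset.sum_congr rfl fun k _ => by
      rw [Matrix.vandermonde_apply, Matrix.of_apply, mul_comm]
  rw [key v, key v', Matrix.det_mul, Matrix.det_mul]
  ring

/-- The entries of `binomMatrix` after extracting row factors, as polynomials in the row index. -/
noncomputable def binomPoly (m N j : ℕ) : Polynomial ℚ :=
  (∏ t ∈ Finset.range j, (Polynomial.C 2 * Polynomial.X + Polynomial.C (1 - t : ℚ))) *
    ∏ t ∈ Finset.range (N - 1 - j), (Polynomial.C (m + N - 1 - t : ℚ) - Polynomial.X)

lemma natDegree_binomPoly (m N j : ℕ) (hj : j < N) : (binomPoly m N j).natDegree < N := by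
  have h1 : (∏ t ∈ Finset.range j,
      (Polynomial.C 2 * Polynomial.X + Polynomial.C (1 - t : ℚ))).natDegree ≤ j := by
    refine (Polynomial.natDegree_prod_le _ _).trans ?_
    refine (Finset.sum_le_sum (g := fun _ => 1) fun t _ => ?_).trans (by simp)
    exact Polynomial.natDegree_linear_le
  have h2 : (∏ t ∈ Finset.range (N - 1 - j),
      (Polynomial.C (m + N - 1 - t : ℚ) - Polynomial.X)).natDegree ≤ N - 1 - j := by
    refine (Polynomial.natDegree_prod_le _ _).trans ?_
    refine (Finset.sum_le_sum (g := fun _ => 1) fun t _ => ?_).trans (by simp)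
    exact (Polynomial.natDegree_sub_le _ _).trans
      (by rw [Polynomial.natDegree_C, Polynomial.natDegree_X]; simp)
  have := (Polynomial.natDegree_mul_le (p := ∏ t ∈ Finset.range j,
      (Polynomial.C 2 * Polynomial.X + Polynomial.C (1 - t : ℚ))) (q := ∏ t ∈
      Finset.range (N - 1 - j), (Polynomial.C (m + N - 1 - t : ℚ) - Polynomial.X)))
  rw [binomPoly]
  omega

lemma eval_binomPoly (m N j : ℕ) (x : ℚ) : (binomPoly m N j).eval x =
    (∏ t ∈ Finset.range j, (2 * x + (1 - t))) *
      ∏ t ∈ Finset.range (N - 1 - j), (m + N - 1 - t - x) := by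
  simp [binomPoly, Polynomial.eval_prod]

lemma cast_descFactorial_eq_prod (a k : ℕ) :
    ((a.descFactorial k : ℕ) : ℚ) = ∏ t ∈ Finset.range k, ((a : ℚ) - t) := by
  induction k with
  | zero => simp
  | succ k ih =>
    rw [Nat.descFactorial_succ, Finset.prod_range_succ, ← ih]
    rcases le_or_gt k a with h | h
    · push_cast [h]
      ring
    · rw [Nat.descFactorial_of_lt h]
      simp

lemma eval_binomPoly_natCast {m N i j : ℕ} (hi : i < N) :
    (binomPoly m N j).eval (i : ℚ) =
      ((2 * i + 1).descFactorial j * (m + N - 1 - i).descFactorial (N - 1 - j) : ℕ) := by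
  rw [eval_binomPoly, Nat.cast_mul, cast_descFactorial_eq_prod, cast_descFactorial_eq_prod]
  congr 1 <;> refine Finset.prod_congr rfl fun t _ => ?_
  · push_cast
    ring
  · have : m + N - 1 - i = m + (N - 1 - i) := by omega
    rw [this, Nat.sub_sub]
    push_cast [show 1 + i ≤ N by omega]
    ring

/-- The matrix of `binom(m + r, 2 r - c)` with `r, c = 1, …, N`. -/
def binomMatrix (m N : ℕ) : Matrix (Fin N) (Fin N) ℚ :=
  Matrix.of fun i j => if (j : ℕ) ≤ 2 * i + 1 then ((m + i + 1).choose (2 * i + 1 - j) : ℚ) else 0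

lemma binomMatrix_apply (m N : ℕ) (i j : Fin N) : binomMatrix m N i j =
    (((m + i + 1).factorial : ℚ) /
      ((2 * (i : ℕ) + 1).factorial * (m + N - 1 - i).factorial)) *
      (binomPoly m N j).eval (i : ℚ) := by
  obtain ⟨i, hi⟩ := i
  obtain ⟨j, hj⟩ := j
  simp only [binomMatrix, Matrix.of_apply]
  rw [eval_binomPoly_natCast hi, div_mul_eq_mul_div, eq_div_iff (by positivity)]
  split_ifs with h
  · norm_cast
    rcases Nat.lt_or_ge (m + j) i with h2 | h2
    · rw [Nat.choose_eq_zero_of_lt (by omega),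
        Nat.descFactorial_of_lt (n := m + N - 1 - i) (by omega)]
      simp
    · have e1 := Nat.choose_mul_factorial_mul_factorial
        (show 2 * i + 1 - j ≤ m + i + 1 by omega)
      have e2 := Nat.factorial_mul_descFactorial h
      have e3 := Nat.factorial_mul_descFactorial
        (show N - 1 - j ≤ m + N - 1 - i by omega)
      rw [show m + N - 1 - i - (N - 1 - j) = m + i + 1 - (2 * i + 1 - j) by omega] at e3
      rw [← e1, ← e2, ← e3]
      ring
  · rw [Nat.descFactorial_of_lt (n := 2 * i + 1) (by omega)]
    simp

/-- The value `det_binomMatrix` is first brought to. -/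
lemma prod_binomMatrix_eq (m N : ℕ) :
    (∏ i ∈ Finset.range N, ((m + i + 1).factorial : ℚ) /
        ((2 * i + 1).factorial * (m + N - 1 - i).factorial)) *
      (∏ i ∈ Finset.range N, (i.factorial : ℚ) *
        ∏ t ∈ Finset.range (N - 1 - i), (2 * m + 2 * N - 2 * t - 1 - i : ℚ)) =
    ∏ i ∈ Finset.range N, ∏ t ∈ Finset.range (i + 1),
      ((2 * m + i + t + 2 : ℚ) / (i + t + 2)) := by
  induction N with
  | zero => simp
  | succ N ih =>
    rw [Finset.prod_range_succ (fun i => ∏ t ∈ Finset.range (i + 1), _) N, ← ih]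
    have h1 : (∏ i ∈ Finset.range (N + 1), ((m + i + 1).factorial : ℚ) /
        ((2 * i + 1).factorial * (m + (N + 1) - 1 - i).factorial)) =
        (∏ i ∈ Finset.range N, ((m + i + 1).factorial : ℚ) /
          ((2 * i + 1).factorial * (m + N - 1 - i).factorial)) *
        ((m + N + 1).factorial / ((2 * N + 1).factorial * (m + N).factorial)) := by
      simp only [Finset.prod_div_distrib, Finset.prod_mul_distrib]
      rw [Finset.prod_range_succ, Finset.prod_range_succ (fun i => ((2 * i + 1).factorial : ℚ)),
        Finset.prod_range_succ' (fun i => ((m + (N + 1) - 1 - i).factorial : ℚ))]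
      have : ∀ i, m + (N + 1) - 1 - (i + 1) = m + N - 1 - i := fun i => by omega
      simp only [this]
      rw [show m + (N + 1) - 1 - 0 = m + N by omega, div_mul_div_comm]
      congr 1
      ring
    have h2 : (∏ i ∈ Finset.range (N + 1), (i.factorial : ℚ) *
        ∏ t ∈ Finset.range (N + 1 - 1 - i), (2 * m + 2 * (N + 1 : ℕ) - 2 * t - 1 - i : ℚ)) =
        (∏ i ∈ Finset.range N, (i.factorial : ℚ) *
          ∏ t ∈ Finset.range (N - 1 - i), (2 * m + 2 * N - 2 * t - 1 - i : ℚ)) *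
        (N.factorial * ∏ i ∈ Finset.range N, (2 * m + 2 * N + 1 - i : ℚ)) := by
      rw [Finset.prod_range_succ, show N + 1 - 1 - N = 0 by omega, Finset.range_zero,
        Finset.prod_empty, mul_one, mul_comm (N.factorial : ℚ), ← mul_assoc,
        ← Finset.prod_mul_distrib]
      congr 1
      refine Finset.prod_congr rfl fun i hi => ?_
      rw [Finset.mem_range] at hi
      rw [show N + 1 - 1 - i = (N - 1 - i) + 1 by omega, Finset.prod_range_succ', mul_assoc]
      congr 2
      · refine Finset.prod_congr rfl fun t _ => ?_
        push_cast
        ring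
      · push_cast
        ring
    have h3 : ∏ t ∈ Finset.range (N + 1), ((2 * m + N + t + 2 : ℚ) / (N + t + 2)) =
        (∏ i ∈ Finset.range N, (2 * m + 2 * N + 1 - i : ℚ)) * (2 * m + 2 * N + 2) *
          ((N + 1).factorial / (2 * N + 2).factorial) := by
      rw [Finset.prod_div_distrib]
      have h4 : ((N + 1).factorial : ℚ) * ∏ t ∈ Finset.range (N + 1), (N + t + 2 : ℚ) =
          (2 * N + 2).factorial := by
        have h5 := Nat.factorial_mul_ascFactorial (N + 1) (N + 1)
        rw [Nat.ascFactorial_eq_prod_range, show N + 1 + (N + 1) = 2 * N + 2 by ring] at h5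
        rw [← h5]
        push_cast
        congr 1
        exact Finset.prod_congr rfl fun t _ => by ring
      have h6 : ∏ t ∈ Finset.range (N + 1), (2 * m + N + t + 2 : ℚ) =
          (∏ i ∈ Finset.range N, (2 * m + 2 * N + 1 - i : ℚ)) * (2 * m + 2 * N + 2) := by
        rw [Finset.prod_range_succ, ← Finset.prod_range_reflect]
        congr 1
        · refine Finset.prod_congr rfl fun t ht => ?_
          rw [Finset.mem_range] at ht
          rw [Nat.sub_sub]
          push_cast [show 1 + t ≤ N by omega]
          ring
        · ring
      have h7 : ((N + 1).factorial : ℚ) ≠ 0 := by positivity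
      rw [h6, ← h4, div_mul_eq_div_div, div_self h7, mul_one_div]
    rw [h1, h2, h3]
    have e1 : ((2 * N + 2).factorial : ℚ) = (2 * N + 2) * (2 * N + 1).factorial := by
      rw [Nat.factorial_succ (2 * N + 1)]
      push_cast
      ring
    have e2 : ((N + 1).factorial : ℚ) = (N + 1) * N.factorial := by
      rw [Nat.factorial_succ]
      push_cast
      ring
    have e3 : ((m + N + 1).factorial : ℚ) = (m + N + 1) * (m + N).factorial := by
      rw [Nat.factorial_succ]
      push_cast
      ring
    rw [e1, e2, e3]
    have : (N + 1 : ℚ) ≠ 0 := by positivity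
    have : (2 * N + 2 : ℚ) ≠ 0 := by positivity
    have : ((m + N).factorial : ℚ) ≠ 0 := by positivity
    have : ((2 * N + 1).factorial : ℚ) ≠ 0 := by positivity
    generalize (∏ i ∈ Finset.range N, ((m + i + 1).factorial : ℚ) /
      ((2 * i + 1).factorial * (m + N - 1 - i).factorial)) = A
    field_simp

lemma det_binomMatrix (m N : ℕ) : (binomMatrix m N).det =
    ∏ i ∈ Finset.range N, ∏ t ∈ Finset.range (i + 1),
      ((2 * m + i + t + 2 : ℚ) / (i + t + 2)) := by
  rw [← prod_binomMatrix_eq]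
  set c : ℕ → ℚ := fun i => ((m + i + 1).factorial : ℚ) /
    ((2 * i + 1).factorial * (m + N - 1 - i).factorial)
  have hM : binomMatrix m N = Matrix.of fun i j : Fin N =>
      c i * (Matrix.of fun i j : Fin N => (binomPoly m N j).eval ((i : ℕ) : ℚ)) i j := by
    ext i j
    rw [binomMatrix_apply, Matrix.of_apply, Matrix.of_apply]
  rw [hM, Matrix.det_mul_column, Fin.prod_univ_eq_prod_range c]
  congr 1
  have hv := det_eval_mul_det_vandermonde (fun j : Fin N => binomPoly m N j)
    (fun j => natDegree_binomPoly m N j j.2) (fun i => ((i : ℕ) : ℚ))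
    (fun i => (((i : ℕ) : ℚ) - 1) / 2)
  have hV : (Matrix.vandermonde fun i : Fin N => ((i : ℕ) : ℚ)).det =
      (∏ i : Fin N, (2 : ℚ) ^ (N - 1 - (i : ℕ))) *
        (Matrix.vandermonde fun i : Fin N => (((i : ℕ) : ℚ) - 1) / 2).det := by
    rw [Matrix.det_vandermonde, Matrix.det_vandermonde, ← Finset.prod_mul_distrib]
    refine Finset.prod_congr rfl fun i _ => ?_
    rw [← Fin.card_Ioi, ← Finset.prod_const, ← Finset.prod_mul_distrib]
    exact Finset.prod_congr rfl fun j _ => by ring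
  have hV0 : (Matrix.vandermonde fun i : Fin N => (((i : ℕ) : ℚ) - 1) / 2).det ≠ 0 := by
    rw [Matrix.det_vandermonde_ne_zero_iff]
    intro a b hab
    have : ((a : ℕ) : ℚ) = (b : ℕ) := by
      have : (((a : ℕ) : ℚ) - 1) / 2 = (((b : ℕ) : ℚ) - 1) / 2 := hab
      linarith
    exact Fin.ext (by exact_mod_cast this)
  rw [hV, ← mul_assoc] at hv
  rw [mul_right_cancel₀ hV0 hv, Matrix.det_of_isLowerTriangular, ← Finset.prod_mul_distrib,
    ← Fin.prod_univ_eq_prod_range (fun i => (i.factorial : ℚ) *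
        ∏ t ∈ Finset.range (N - 1 - i), (2 * m + 2 * N - 2 * t - 1 - i : ℚ))]
  · refine Finset.prod_congr rfl fun i _ => ?_
    rw [Matrix.of_apply, eval_binomPoly, mul_assoc]
    congr 1
    · rw [← Nat.descFactorial_self, cast_descFactorial_eq_prod]
      exact Finset.prod_congr rfl fun t _ => by ring
    · conv_lhs => rw [mul_comm]
      rw [← Finset.card_range (N - 1 - (i : ℕ)), ← Finset.prod_const, Finset.card_range,
        ← Finset.prod_mul_distrib]
      exact Finset.prod_congr rfl fun t _ => by ring
  · intro i j hij
    have hij' : (i : ℕ) < j := hij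
    rw [Matrix.of_apply, eval_binomPoly]
    refine mul_eq_zero_of_left ?_ _
    exact Finset.prod_eq_zero (Finset.mem_range.2 hij') (by ring)

end BlockReversal

section DividedDifferences

/-! ### Divided differences -/

open Polynomial

/-- Families of pairwise distinct rational numbers. -/
abbrev Pt : Type := {y : ℕ → ℚ // Function.Injective y}

/-- Swapping two neighbouring coordinates. -/
def Pt.swap (i : ℕ) (y : Pt) : Pt := ⟨y.1 ∘ sT i, y.2.comp (sT i).injective⟩

lemma Pt.swap_apply (i j : ℕ) (y : Pt) : (y.swap i).1 j = y.1 (sT i j) := rfl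

lemma Pt.swap_swap (i : ℕ) (y : Pt) : (y.swap i).swap i = y := by
  ext j
  rw [Pt.swap_apply, Pt.swap_apply, sT_sT]

lemma Pt.swap_comm {i j : ℕ} (h : i + 2 ≤ j) (y : Pt) :
    (y.swap i).swap j = (y.swap j).swap i := by
  ext x
  simp only [Pt.swap_apply, ← Equiv.Perm.mul_apply, sT_comm h]

lemma Pt.swap_braid (i : ℕ) (y : Pt) : ((y.swap i).swap (i + 1)).swap i =
    ((y.swap (i + 1)).swap i).swap (i + 1) := by
  ext x
  simp only [Pt.swap_apply, ← Equiv.Perm.mul_apply, ← mul_assoc, sT_braid]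

lemma Pt.sub_ne_zero (y : Pt) {i j : ℕ} (h : i ≠ j) : y.1 i - y.1 j ≠ 0 :=
  _root_.sub_ne_zero.2 (y.2.ne h)

/-- The divided difference operator that exchanges the coordinates `i` and `i + 1`. -/
noncomputable def divDiff (i : ℕ) : Module.End ℚ (Pt → ℚ[X]) where
  toFun f y := (y.1 (i + 1) - y.1 i)⁻¹ • (f y - f (y.swap i))
  map_add' f g := by
    ext1 y
    simp only [Pi.add_apply, ← smul_add]
    congr 1
    ring
  map_smul' c f := by
    ext1 y
    simp only [Pi.smul_apply, RingHom.id_apply, ← smul_sub, smul_comm c]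

lemma divDiff_apply (i : ℕ) (f : Pt → ℚ[X]) (y : Pt) :
    divDiff i f y = (y.1 (i + 1) - y.1 i)⁻¹ • (f y - f (y.swap i)) := rfl

lemma divDiff_mul_self (i : ℕ) : divDiff i * divDiff i = 0 := by
  ext1 f
  ext1 y
  simp only [Module.End.mul_apply, divDiff_apply, Pt.swap_apply, Pt.swap_swap, sT_left, sT_right,
    LinearMap.zero_apply, Pi.zero_apply]
  have h := y.sub_ne_zero (show i + 1 ≠ i by omega)
  have h' := y.sub_ne_zero (show i ≠ i + 1 by omega)
  match_scalars <;> field_simp <;> ring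

lemma divDiff_comm {i j : ℕ} (h : i + 2 ≤ j) :
    divDiff i * divDiff j = divDiff j * divDiff i := by
  ext1 f
  ext1 y
  simp only [Module.End.mul_apply, divDiff_apply, Pt.swap_apply, Pt.swap_comm h]
  rw [sT_of_ne (i := i) (x := j) (by omega) (by omega),
    sT_of_ne (i := i) (x := j + 1) (by omega) (by omega),
    sT_of_ne (i := j) (x := i) (by omega) (by omega),
    sT_of_ne (i := j) (x := i + 1) (by omega) (by omega)]
  match_scalars <;> ring

lemma divDiff_braid (i : ℕ) : divDiff i * divDiff (i + 1) * divDiff i =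
    divDiff (i + 1) * divDiff i * divDiff (i + 1) := by
  ext1 f
  ext1 y
  have e0 : sT (i + 1) i = i := sT_of_ne (by omega) (by omega)
  have e1 : sT (i + 1) (i + 1) = i + 2 := sT_left _
  have e2 : sT (i + 1) (i + 2) = i + 1 := sT_right _
  have e3 : sT i (i + 2) = i + 2 := sT_of_ne (by omega) (by omega)
  simp only [Module.End.mul_apply, divDiff_apply, Pt.swap_apply, Pt.swap_swap, Pt.swap_braid,
    e0, e1, e2, e3, sT_left, sT_right, show i + 1 + 1 = i + 2 from rfl]
  have h1 := y.sub_ne_zero (show i + 1 ≠ i by omega)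
  have h2 := y.sub_ne_zero (show i + 2 ≠ i by omega)
  have h3 := y.sub_ne_zero (show i + 2 ≠ i + 1 by omega)
  have h4 := y.sub_ne_zero (show i ≠ i + 1 by omega)
  have h5 := y.sub_ne_zero (show i ≠ i + 2 by omega)
  have h6 := y.sub_ne_zero (show i + 1 ≠ i + 2 by omega)
  match_scalars <;> field_simp <;> ring

/-- Divided differences, with the first ones set to zero. -/
noncomputable def truncDiff (m i : ℕ) : Module.End ℚ (Pt → ℚ[X]) := if m < i then divDiff i else 0

lemma truncDiff_mul_self (m i : ℕ) : truncDiff m i * truncDiff m i = 0 := by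
  unfold truncDiff
  split_ifs
  · exact divDiff_mul_self i
  · exact zero_mul _

lemma truncDiff_comm (m i j : ℕ) (h : i + 2 ≤ j) :
    truncDiff m i * truncDiff m j = truncDiff m j * truncDiff m i := by
  unfold truncDiff
  split_ifs
  · exact divDiff_comm h
  all_goals simp

lemma truncDiff_braid (m i : ℕ) : truncDiff m i * truncDiff m (i + 1) * truncDiff m i =
    truncDiff m (i + 1) * truncDiff m i * truncDiff m (i + 1) := by
  unfold truncDiff
  split_ifs
  · exact divDiff_braid i
  · omega
  all_goals simp

/-- The pointwise derivative. -/
noncomputable def ptDeriv : Module.End ℚ (Pt → ℚ[X]) where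
  toFun f y := derivative (f y)
  map_add' f g := by
    ext1 y
    simp
  map_smul' c f := by
    ext1 y
    simp

lemma ptDeriv_apply (f : Pt → ℚ[X]) (y : Pt) : ptDeriv f y = derivative (f y) := rfl

lemma ptDeriv_mul_truncDiff (m i : ℕ) : ptDeriv * truncDiff m i = truncDiff m i * ptDeriv := by
  unfold truncDiff
  split_ifs
  · ext1 f
    ext1 y
    simp only [Module.End.mul_apply, ptDeriv_apply, divDiff_apply, derivative_smul,
      derivative_sub]
  · simp

/-! ### Elementary symmetric polynomials of shifted variables -/

/-- The elementary symmetric polynomial of degree `k` in `m` copies of `X` and the `r`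
variables `y n + X, y (n - 1) + X, …`. -/
noncomputable def esym (m n : ℕ) : ℕ → ℤ → Pt → ℚ[X]
  | 0, k, _ => if k < 0 then 0 else C (m.choose k.toNat : ℚ) * X ^ k.toNat
  | r + 1, k, y => esym m n r k y + (C (y.1 (n - r)) + X) * esym m n r (k - 1) y

variable {m n : ℕ}

lemma esym_succ (r : ℕ) (k : ℤ) (y : Pt) : esym m n (r + 1) k y =
    esym m n r k y + (C (y.1 (n - r)) + X) * esym m n r (k - 1) y := rfl

lemma esym_of_neg (r : ℕ) {k : ℤ} (hk : k < 0) (y : Pt) : esym m n r k y = 0 := by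
  induction r generalizing k with
  | zero => exact if_pos hk
  | succ r ih => rw [esym_succ, ih hk, ih (by omega), mul_zero, add_zero]

lemma esym_zero_natCast (k : ℕ) (y : Pt) :
    esym m n 0 k y = C (m.choose k : ℚ) * X ^ k := by
  rw [esym, if_neg (by omega), Int.toNat_natCast]

lemma derivative_esym (r : ℕ) (k : ℤ) (y : Pt) :
    derivative (esym m n r k y) = C (m + r - k + 1 : ℚ) * esym m n r (k - 1) y := by
  induction r generalizing k with
  | zero =>
    rcases lt_trichotomy k 0 with hk | rfl | hk
    · rw [esym_of_neg _ hk, esym_of_neg _ (by omega)]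
      simp
    · rw [esym_of_neg _ (show (0 : ℤ) - 1 < 0 by omega)]
      simp [esym]
    · obtain ⟨j, rfl⟩ : ∃ j : ℕ, k = j + 1 := ⟨(k - 1).toNat, by omega⟩
      rw [add_sub_cancel_right, esym_zero_natCast,
        show (j + 1 : ℤ) = ((j + 1 : ℕ) : ℤ) by norm_cast, esym_zero_natCast,
        derivative_C_mul_X_pow, ← mul_assoc, ← C_mul]
      congr 2
      rcases le_or_gt j m with h | h
      · have := Nat.choose_succ_right_eq m j
        have h2 : (m.choose (j + 1) * (j + 1) : ℚ) = m.choose j * (m - j) := by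
          rw [← Nat.cast_sub h]
          exact_mod_cast this
        push_cast
        linarith
      · rw [Nat.choose_eq_zero_of_lt h, Nat.choose_eq_zero_of_lt (by omega)]
        simp
  | succ r ih =>
    rw [esym_succ, esym_succ, derivative_add, derivative_mul, ih, ih]
    simp only [derivative_add, derivative_C, derivative_X, zero_add, one_mul]
    have : (C (m + (r + 1 : ℕ) - k + 1 : ℚ) : ℚ[X]) = C (m + r - k + 1 : ℚ) + 1 := by
      rw [← C_1, ← C_add]
      push_cast
      ring_nf
    have h2 : (C (m + r - (k - 1 : ℤ) + 1 : ℚ) : ℚ[X]) = C (m + r - k + 1 : ℚ) + 1 := by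
      rw [← C_1, ← C_add]
      push_cast
      ring_nf
    rw [this, h2]
    ring

lemma natDegree_esym_le (r k : ℕ) (y : Pt) : (esym m n r k y).natDegree ≤ k := by
  induction r generalizing k with
  | zero =>
    rw [esym_zero_natCast]
    exact natDegree_C_mul_X_pow_le _ _
  | succ r ih =>
    rw [esym_succ]
    refine natDegree_add_le_of_degree_le (ih k) ?_
    cases k with
    | zero =>
      rw [esym_of_neg _ (by simp), mul_zero]
      simp
    | succ k =>
      rw [show ((k + 1 : ℕ) : ℤ) - 1 = k by push_cast; ring, add_comm k 1]
      refine natDegree_mul_le_of_le ?_ (ih k)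
      rw [add_comm, natDegree_X_add_C]

lemma coeff_esym (r k : ℕ) (y : Pt) : (esym m n r k y).coeff k = (m + r).choose k := by
  induction r generalizing k with
  | zero =>
    rw [esym_zero_natCast]
    simp
  | succ r ih =>
    rw [esym_succ, coeff_add, ih]
    cases k with
    | zero =>
      rw [esym_of_neg _ (by simp), mul_zero]
      simp
    | succ k =>
      rw [show ((k + 1 : ℕ) : ℤ) - 1 = k by push_cast; ring, add_mul, coeff_add, coeff_C_mul,
        coeff_X_mul, ih, coeff_eq_zero_of_natDegree_lt
          (Nat.lt_succ_of_le (natDegree_esym_le r k y)),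
        show m + (r + 1) = m + r + 1 from rfl, Nat.choose_succ_succ']
      push_cast
      ring

lemma esym_swap_of_lt {r i : ℕ} (hri : r < i) (hin : i ≤ n) (k : ℤ) (y : Pt) :
    esym m n r k (y.swap (n - i)) = esym m n r k y := by
  induction r generalizing k with
  | zero => rfl
  | succ r ih =>
    rw [esym_succ, esym_succ, ih (by omega), ih (by omega), Pt.swap_apply,
      sT_of_ne (by omega) (by omega)]

lemma esym_swap_of_gt {r i : ℕ} (hi : 1 ≤ i) (hri : i < r) (hin : i < n) (k : ℤ) (y : Pt) :
    esym m n r k (y.swap (n - i)) = esym m n r k y := by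
  induction r, hri using Nat.le_induction generalizing k with
  | base =>
    obtain ⟨j, rfl⟩ : ∃ j, i = j + 1 := ⟨i - 1, by omega⟩
    simp only [Nat.succ_eq_add_one, esym_succ, esym_swap_of_lt (show j < j + 1 by omega) hin.le,
      Pt.swap_apply]
    rw [sT_left, show n - j = n - (j + 1) + 1 by omega, sT_right]
    ring
  | succ r hr ih =>
    rw [esym_succ, esym_succ, ih, ih, Pt.swap_apply, sT_of_ne (by omega) (by omega)]

lemma esym_sub_swap {i : ℕ} (hin : i + 1 < n) (k : ℤ) (y : Pt) :
    esym m n (i + 1) k y - esym m n (i + 1) k (y.swap (n - (i + 1))) =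
      C (y.1 (n - (i + 1) + 1) - y.1 (n - (i + 1))) * esym m n i (k - 1) y := by
  simp only [esym_succ, esym_swap_of_lt (show i < i + 1 by omega) hin.le, Pt.swap_apply]
  rw [show n - i = n - (i + 1) + 1 by omega, sT_right, C_sub]
  ring

end DividedDifferences

section Determinants

/-! ### Determinants of elementary symmetric polynomials -/

open Polynomial Matrix

lemma det_updateRow_eq_sum {R ι : Type*} [CommRing R] [Fintype ι] [DecidableEq ι]
    (M : Matrix ι ι R) (r : ι) (v : ι → R) :
    (M.updateRow r v).det = ∑ c, v c * M.adjugate c r := by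
  rw [← cramer_transpose_apply, cramer_eq_adjugate_mulVec, ← adjugate_transpose]
  exact Finset.sum_congr rfl fun c _ => mul_comm _ _

/-- Jacobi's formula. -/
lemma derivative_det {R ι : Type*} [CommRing R] [Fintype ι] [DecidableEq ι]
    (M : Matrix ι ι R[X]) :
    derivative M.det = ∑ c, ∑ r, derivative (M r c) * M.adjugate c r := by
  have key : ∀ c, ∑ r, derivative (M r c) * M.adjugate c r =
      ∑ σ : Equiv.Perm ι, Equiv.Perm.sign σ •
        ((∏ b ∈ Finset.univ.erase c, M (σ b) b) * derivative (M (σ c) c)) := by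
    intro c
    have h1 : ∑ r, derivative (M r c) * M.adjugate c r =
        (M.updateCol c fun r => derivative (M r c)).det := by
      rw [← cramer_apply, cramer_eq_adjugate_mulVec]
      exact Finset.sum_congr rfl fun r _ => mul_comm _ _
    rw [h1, det_apply]
    refine Finset.sum_congr rfl fun σ _ => ?_
    rw [← Finset.mul_prod_erase _ _ (Finset.mem_univ c), updateCol_self, mul_comm]
    congr 2
    refine Finset.prod_congr rfl fun b hb => ?_
    rw [updateCol_ne (Finset.ne_of_mem_erase hb)]
  simp only [key]
  rw [det_apply, derivative_sum, Finset.sum_comm]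
  refine Finset.sum_congr rfl fun σ _ => ?_
  rw [Units.smul_def, derivative_smul, derivative_prod_finset, ← Units.smul_def,
    Finset.smul_sum]

/-- The matrix with rows of elementary symmetric polynomials of descending degrees. -/
noncomputable def esymMatrix (m n : ℕ) {N : ℕ} (f : Fin N → ℕ) (k : Fin N → ℤ) (y : Pt) :
    Matrix (Fin N) (Fin N) ℚ[X] :=
  Matrix.of fun r c => esym m n (f r) (k r - ((c : ℕ) + 1 : ℤ)) y

/-- The determinant of `esymMatrix`. -/
noncomputable def esymDet (m n : ℕ) {N : ℕ} (f : Fin N → ℕ) (k : Fin N → ℤ) : Pt → ℚ[X] :=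
  fun y => (esymMatrix m n f k y).det

variable {m n N : ℕ}

lemma esymMatrix_apply (f : Fin N → ℕ) (k : Fin N → ℤ) (y : Pt) (r c : Fin N) :
    esymMatrix m n f k y r c = esym m n (f r) (k r - ((c : ℕ) + 1 : ℤ)) y := rfl

lemma esymMatrix_update (f : Fin N → ℕ) (k : Fin N → ℤ) (y : Pt) (r : Fin N) (a : ℕ) (b : ℤ) :
    esymMatrix m n (Function.update f r a) (Function.update k r b) y =
      (esymMatrix m n f k y).updateRow r fun c => esym m n a (b - ((c : ℕ) + 1 : ℤ)) y := by
  ext1 s c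
  rcases eq_or_ne s r with rfl | h
  · rw [esymMatrix_apply, updateRow_self, Function.update_self, Function.update_self]
  · rw [esymMatrix_apply, updateRow_ne h, Function.update_of_ne h, Function.update_of_ne h,
      esymMatrix_apply]

lemma divDiff_esymDet (f : Fin N → ℕ) (k : Fin N → ℤ) {i : ℕ} (hin : i + 1 < n) (r : Fin N)
    (hr : f r = i + 1) (hne : ∀ s, s ≠ r → f s ≠ i + 1) :
    divDiff (n - (i + 1)) (esymDet m n f k) =
      esymDet m n (Function.update f r i) (Function.update k r (k r - 1)) := by
  ext1 y
  rw [divDiff_apply]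
  unfold esymDet
  rw [esymMatrix_update]
  set M := esymMatrix m n f k y with hM
  set M' := esymMatrix m n f k (y.swap (n - (i + 1))) with hM'
  set v : Fin N → ℚ[X] := fun c => esym m n i (k r - 1 - ((c : ℕ) + 1 : ℤ)) y with hv
  have h1 : M' = M.updateRow r (M' r) := by
    ext1 s c
    rcases eq_or_ne s r with rfl | h
    · rw [updateRow_self]
    · rw [updateRow_ne h, hM, hM', esymMatrix_apply, esymMatrix_apply]
      rcases lt_or_gt_of_ne (hne s h) with h2 | h2
      · exact esym_swap_of_lt h2 hin.le _ _
      · exact esym_swap_of_gt (by omega) h2 hin _ _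
  have h2 : M = M.updateRow r
      (M' r + C (y.1 (n - (i + 1) + 1) - y.1 (n - (i + 1))) • v) := by
    ext1 s c
    rcases eq_or_ne s r with rfl | h
    · rw [updateRow_self, Pi.add_apply, Pi.smul_apply, smul_eq_mul, hv, ← sub_eq_iff_eq_add',
        hM, hM', esymMatrix_apply, esymMatrix_apply, hr, esym_sub_swap hin]
      congr 2
      ring
    · rw [updateRow_ne h]
  have h3 : M.det = M'.det + C (y.1 (n - (i + 1) + 1) - y.1 (n - (i + 1))) *
      (M.updateRow r v).det := by
    conv_lhs => rw [h2]
    rw [det_updateRow_add, det_updateRow_smul, ← h1]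
  rw [h3, add_sub_cancel_left, ← smul_eq_C_mul, smul_smul,
    inv_mul_cancel₀ (y.sub_ne_zero (by omega)), one_smul]

/-- The flagged determinant of the staircase shape. -/
noncomputable def stairDet (m n N : ℕ) : Pt → ℚ[X] :=
  esymDet m n (fun r : Fin N => (r : ℕ) + 1) (fun r => 2 * (r : ℕ) + 2)

lemma sum_smul_truncDiff (hn : n = m + 1 + N) (P : Pt → ℚ[X]) :
    ∑ a ∈ Finset.range n, (a : ℚ) • truncDiff m a P =
      ∑ r : Fin N, (m + N - r : ℚ) • divDiff (n - (r + 1)) P := by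
  rw [hn, Finset.sum_range_add, ← hn, Finset.sum_eq_zero, zero_add,
    ← Finset.sum_range_reflect, ← Fin.sum_univ_eq_sum_range
      (fun r => ((m + 1 + (N - 1 - r) : ℕ) : ℚ) •
        truncDiff m (m + 1 + (N - 1 - r)) P)]
  · refine Finset.sum_congr rfl fun r _ => ?_
    have hr := r.2
    rw [truncDiff, if_pos (by omega), show m + 1 + (N - 1 - (r : ℕ)) = n - (r + 1) by omega,
      hn, Nat.cast_sub (by omega)]
    congr 1
    push_cast
    ring
  · intro a ha
    rw [Finset.mem_range] at ha
    rw [truncDiff, if_neg (by omega), LinearMap.zero_apply, smul_zero]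

/-- The matrix of the staircase determinant. -/
noncomputable abbrev stairMatrix (m n N : ℕ) (y : Pt) : Matrix (Fin N) (Fin N) ℚ[X] :=
  esymMatrix m n (fun r : Fin N => (r : ℕ) + 1) (fun r => 2 * (r : ℕ) + 2) y

lemma stairMatrix_apply (y : Pt) (r c : Fin N) : stairMatrix m n N y r c =
    esym m n (r + 1) (2 * (r : ℕ) + 2 - ((c : ℕ) + 1 : ℤ)) y := rfl

lemma stairDet_apply (y : Pt) : stairDet m n N y = (stairMatrix m n N y).det := rfl

lemma divDiff_stairDet (hn : N < n) (y : Pt) (r : Fin N) :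
    divDiff (n - (r + 1)) (stairDet m n N) y =
      ∑ c : Fin N, esym m n r (2 * (r : ℕ) - (c : ℕ) : ℤ) y *
        (stairMatrix m n N y).adjugate c r := by
  have hr := r.2
  rw [stairDet, divDiff_esymDet _ _ (by omega) r rfl
    (fun s hs h => hs (Fin.ext (by simpa using h))), esymDet, esymMatrix_update,
    det_updateRow_eq_sum]
  refine Finset.sum_congr rfl fun c _ => ?_
  congr 2
  ring

lemma sum_esym_mul_adjugate (y : Pt) (r : Fin N) :
    ∑ c : Fin N, esym m n r (2 * (r : ℕ) - (c : ℕ) : ℤ) y * (stairMatrix m n N y).adjugate c r =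
      ∑ c : Fin N, esym m n (r + 1) (2 * (r : ℕ) - (c : ℕ) : ℤ) y *
        (stairMatrix m n N y).adjugate c r := by
  have h0 : ∑ c : Fin N, esym m n r (2 * (r : ℕ) - (c : ℕ) - 1 : ℤ) y *
      (stairMatrix m n N y).adjugate c r = 0 := by
    obtain ⟨r, hr⟩ := r
    cases r with
    | zero =>
      refine Finset.sum_eq_zero fun c _ => ?_
      rw [esym_of_neg _ (by simp; omega), zero_mul]
    | succ r =>
      have h := congrFun (congrFun (mul_adjugate (stairMatrix m n N y)) ⟨r, by omega⟩) ⟨r + 1, hr⟩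
      rw [Matrix.smul_apply, one_apply_ne (by simp), smul_zero, mul_apply] at h
      rw [← h]
      refine Finset.sum_congr rfl fun c _ => ?_
      rw [stairMatrix_apply]
      congr 2
      push_cast
      ring
  simp only [esym_succ, add_mul, Finset.sum_add_distrib, mul_assoc, ← Finset.mul_sum, h0,
    mul_zero, add_zero]

lemma smul_sum_esym_mul_adjugate (y : Pt) (c : Fin N) : (N - 1 - (c : ℕ) : ℚ) •
    ∑ r : Fin N, esym m n (r + 1) (2 * (r : ℕ) - (c : ℕ) : ℤ) y *
      (stairMatrix m n N y).adjugate c r = 0 := by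
  have hc := c.2
  rcases Nat.lt_or_ge ((c : ℕ) + 1) N with h | h
  · have h2 := congrFun (congrFun (adjugate_mul (stairMatrix m n N y)) c) ⟨c + 1, h⟩
    rw [Matrix.smul_apply, one_apply_ne (by simp [Fin.ext_iff]), smul_zero, mul_apply] at h2
    refine (congrArg _ (Eq.trans (Finset.sum_congr rfl fun r _ => ?_) h2)).trans (smul_zero _)
    rw [stairMatrix_apply, mul_comm]
    congr 2
    push_cast
    ring
  · have : (N : ℚ) = (c : ℕ) + 1 := by exact_mod_cast (show N = (c : ℕ) + 1 by omega)
    rw [show (N - 1 - (c : ℕ) : ℚ) = 0 by rw [this]; ring, zero_smul]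

lemma ptDeriv_stairDet_apply (y : Pt) : ptDeriv (stairDet m n N) y =
    ∑ c : Fin N, ∑ r : Fin N, (m - r + c + 1 : ℚ) •
      (esym m n (r + 1) (2 * (r : ℕ) - (c : ℕ) : ℤ) y * (stairMatrix m n N y).adjugate c r) := by
  rw [ptDeriv_apply, stairDet, esymDet, derivative_det]
  refine Finset.sum_congr rfl fun c _ => Finset.sum_congr rfl fun r _ => ?_
  rw [esymMatrix_apply, derivative_esym, smul_eq_C_mul, mul_assoc]
  congr 2
  · congr 1
    push_cast
    ring
  · congr 1
    ring

/-- The pointwise derivative of the staircase determinant. -/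
lemma ptDeriv_stairDet (m N : ℕ) : ptDeriv (stairDet m (m + 1 + N) N) =
    ∑ a ∈ Finset.range (m + 1 + N),
      (a : ℚ) • truncDiff m a (stairDet m (m + 1 + N) N) := by
  rw [sum_smul_truncDiff rfl]
  ext1 y
  rw [ptDeriv_stairDet_apply, Finset.sum_apply, ← sub_eq_zero, ← neg_eq_zero, neg_sub]
  simp only [Pi.smul_apply, divDiff_stairDet (show N < m + 1 + N by omega),
    sum_esym_mul_adjugate, Finset.smul_sum]
  rw [Finset.sum_comm, ← Finset.sum_sub_distrib]
  refine Finset.sum_eq_zero fun c _ => ?_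
  rw [← smul_sum_esym_mul_adjugate y c, Finset.smul_sum, ← Finset.sum_sub_distrib]
  refine Finset.sum_congr rfl fun r _ => ?_
  rw [← sub_smul]
  congr 1
  ring

end Determinants

section StaircaseWord

/-! ### The staircase word -/

open Polynomial Matrix

lemma wordEval_append {M : Type*} [Monoid M] (d : ℕ → M) (l l' : List ℕ) :
    wordEval d (l ++ l') = wordEval d l' * wordEval d l := by
  induction l with
  | nil => exact (mul_one _).symm
  | cons i l ih => rw [List.cons_append, wordEval, wordEval, ih, mul_assoc]

lemma wordEval_eq_prod {M : Type*} [Monoid M] (d : ℕ → M) (l : List ℕ) :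
    wordEval d l = (l.reverse.map d).prod := by
  induction l with
  | nil => rfl
  | cons i l ih => simp [wordEval, ih]

lemma wordPerm_eq_prod (l : List ℕ) : wordPerm l = (l.reverse.map sT).prod := by
  induction l with
  | nil => rfl
  | cons i l ih => simp [wordPerm, ih]

lemma wordEval_eq_zero {M : Type*} [MonoidWithZero M] {d : ℕ → M} {l : List ℕ} {i : ℕ}
    (hi : i ∈ l) (hd : d i = 0) : wordEval d l = 0 := by
  rw [wordEval_eq_prod]
  exact List.prod_eq_zero (List.mem_map.2 ⟨i, List.mem_reverse.2 hi, hd⟩)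

/-- The word `n - r, …, n - 2, n - 1`. -/
def descWord (n : ℕ) : ℕ → List ℕ
  | 0 => []
  | i + 1 => (n - (i + 1)) :: descWord n i

/-- A reduced word of the longest permutation of a block. -/
def stairWord (n : ℕ) : ℕ → List ℕ
  | 0 => []
  | r + 1 => stairWord n r ++ descWord n (r + 1)

lemma length_descWord (n i : ℕ) : (descWord n i).length = i := by
  induction i with
  | zero => rfl
  | succ i ih => rw [descWord, List.length_cons, ih]

lemma length_stairWord (n r : ℕ) :
    (stairWord n r).length = ∑ j ∈ Finset.range (r + 1), j := by
  induction r with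
  | zero => rfl
  | succ r ih =>
    rw [stairWord, List.length_append, ih, length_descWord, Finset.sum_range_succ _ (r + 1)]

lemma mem_descWord {n i a : ℕ} (hi : i ≤ n) (ha : a ∈ descWord n i) : n - i ≤ a ∧ a < n := by
  induction i with
  | zero => simp [descWord] at ha
  | succ i ih =>
    rcases List.mem_cons.1 ha with rfl | h
    · omega
    · have := ih (by omega) h
      omega

lemma mem_stairWord {n r a : ℕ} (hr : r ≤ n) (ha : a ∈ stairWord n r) : n - r ≤ a ∧ a < n := by
  induction r with
  | zero => simp [stairWord] at ha
  | succ r ih =>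
    rcases List.mem_append.1 ha with h | h
    · have := ih (by omega) h
      omega
    · exact mem_descWord hr h

variable {m N : ℕ}

/-- The flags met along the staircase word. -/
def stairFlag (N r i : ℕ) (j : Fin N) : ℕ :=
  if (j : ℕ) < r then 0 else if (j : ℕ) = r then i else j + 1

/-- The degrees met along the staircase word. -/
def stairDeg (N r i : ℕ) (j : Fin N) : ℤ :=
  if (j : ℕ) < r then j + 1 else if (j : ℕ) = r then r + 1 + i else 2 * j + 2

lemma wordEval_descWord {r i : ℕ} (hr : r < N) (hi : i ≤ r + 1) :
    wordEval (truncDiff m) (descWord (m + 1 + N) i)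
      (esymDet m (m + 1 + N) (stairFlag N r i) (stairDeg N r i)) =
      esymDet m (m + 1 + N) (stairFlag N r 0) (stairDeg N r 0) := by
  induction i with
  | zero => rfl
  | succ i ih =>
    rw [descWord, wordEval, Module.End.mul_apply, truncDiff, if_pos (by omega),
      divDiff_esymDet _ _ (by omega) ⟨r, hr⟩ (by simp [stairFlag]), ← ih (by omega)]
    · congr 2
      · ext j
        rcases eq_or_ne j ⟨r, hr⟩ with rfl | h
        · simp [stairFlag]
        · have := Fin.val_ne_of_ne h
          simp only at this
          rw [Function.update_of_ne h]
          simp [stairFlag, this]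
      · ext j
        rcases eq_or_ne j ⟨r, hr⟩ with rfl | h
        · simp [stairDeg]
          ring
        · have := Fin.val_ne_of_ne h
          simp only at this
          rw [Function.update_of_ne h]
          simp [stairDeg, this]
    · intro s hs
      have := Fin.val_ne_of_ne hs
      simp only at this
      unfold stairFlag
      split_ifs <;> omega

lemma wordEval_stairWord {r : ℕ} (hr : r ≤ N) :
    wordEval (truncDiff m) (stairWord (m + 1 + N) r) (stairDet m (m + 1 + N) N) =
      esymDet m (m + 1 + N) (stairFlag N r (r + 1)) (stairDeg N r (r + 1)) := by
  induction r with
  | zero =>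
    change stairDet m (m + 1 + N) N = _
    unfold stairDet
    congr 1
    · ext j
      unfold stairFlag
      split_ifs <;> omega
    · ext j
      unfold stairDeg
      split_ifs <;> omega
  | succ r ih =>
    rw [stairWord, wordEval_append, Module.End.mul_apply, ih (by omega),
      wordEval_descWord (by omega) le_rfl]
    congr 1
    · ext j
      unfold stairFlag
      split_ifs <;> omega
    · ext j
      unfold stairDeg
      split_ifs <;> omega

lemma wordEval_stairWord_self :
    wordEval (truncDiff m) (stairWord (m + 1 + N) N) (stairDet m (m + 1 + N) N) = 1 := by
  rw [wordEval_stairWord le_rfl]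
  ext1 y
  have hent : ∀ r c : Fin N, esymMatrix m (m + 1 + N) (stairFlag N N (N + 1))
      (stairDeg N N (N + 1)) y r c = esym m (m + 1 + N) 0 ((r : ℕ) - (c : ℕ) : ℤ) y := by
    intro r c
    rw [esymMatrix_apply, stairFlag, stairDeg, if_pos r.2, if_pos r.2]
    congr 1
    ring
  rw [esymDet, det_of_isLowerTriangular, Finset.prod_eq_one]
  · rfl
  · intro r _
    rw [hent, sub_self]
    simp [esym]
  · intro r c hrc
    rw [hent, esym_of_neg]
    have : (r : ℕ) < c := hrc
    omega

lemma fixes_wordPerm {n : ℕ} {l : List ℕ} (hl : ∀ a ∈ l, m < a ∧ a < n) :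
    ∀ x, x ≤ m ∨ n < x → wordPerm l x = x := by
  induction l with
  | nil => intro x _; rfl
  | cons i l ih =>
    intro x hx
    have hi := hl i List.mem_cons_self
    rw [wordPerm, Equiv.Perm.mul_apply, sT_of_ne (by omega) (by omega)]
    exact ih (fun a ha => hl a (List.mem_cons_of_mem _ ha)) x hx

lemma stairWord_bounds : ∀ a ∈ stairWord (m + 1 + N) N, m < a ∧ a < m + 1 + N := by
  intro a ha
  have := mem_stairWord (by omega) ha
  omega

lemma isWord_stairWord : IsWord (m + 1 + N) (stairWord (m + 1 + N) N) := fun a ha => by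
  have := stairWord_bounds a ha
  omega

lemma isRed_stairWord : IsRed (stairWord (m + 1 + N) N) := by
  rcases isRed_or_wordEval_eq_zero (truncDiff_mul_self m) (truncDiff_comm m) (truncDiff_braid m)
    (isWord_stairWord (m := m) (N := N)) with h | h
  · exact h
  · have h1 := wordEval_stairWord_self (m := m) (N := N)
    rw [h.2, LinearMap.zero_apply] at h1
    have h2 := congrFun h1 ⟨fun i => (i : ℚ), Nat.cast_injective⟩
    simp at h2

lemma wordPerm_eq_blockRev {l : List ℕ} (hl : ∀ a ∈ l, m < a ∧ a < m + 1 + N)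
    (hr : IsRed l) (hlen : l.length = ∑ j ∈ Finset.range (N + 1), j) :
    wordPerm l = blockRev m (N + 1) := by
  have hn : m + (N + 1) = m + 1 + N := by ring
  refine eq_blockRev_of_le_len (fun x hx => fixes_wordPerm hl x (hn ▸ hx)) ?_
  rw [hn, len_wordPerm (fun a ha => ⟨by have := hl a ha; omega, (hl a ha).2⟩) hr, hlen]

lemma wordPerm_stairWord : wordPerm (stairWord (m + 1 + N) N) = blockRev m (N + 1) :=
  wordPerm_eq_blockRev stairWord_bounds isRed_stairWord (length_stairWord _ _)

lemma len_blockRev (m N : ℕ) :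
    len (m + 1 + N) (blockRev m (N + 1)) = ∑ j ∈ Finset.range (N + 1), j := by
  rw [← wordPerm_stairWord, len_wordPerm isWord_stairWord isRed_stairWord, length_stairWord]

open scoped Classical in
lemma wordEval_stairDet {l : List ℕ} (hl : IsWord (m + 1 + N) l)
    (hlen : l.length = ∑ j ∈ Finset.range (N + 1), j) :
    wordEval (truncDiff m) l (stairDet m (m + 1 + N) N) =
      if wordPerm l = blockRev m (N + 1) then 1 else 0 := by
  rcases isRed_or_wordEval_eq_zero (truncDiff_mul_self m) (truncDiff_comm m) (truncDiff_braid m)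
    hl with h | ⟨h, h0⟩
  · split_ifs with hw
    · rw [← wordEval_stairWord_self]
      congr 1
      exact wordEval_eq_of_isRed (truncDiff_comm m) (truncDiff_braid m) hl isWord_stairWord h
        isRed_stairWord (hw.trans wordPerm_stairWord.symm)
    · obtain ⟨a, ha, ham⟩ : ∃ a ∈ l, a ≤ m := by
        by_contra! hc
        exact hw (wordPerm_eq_blockRev (fun a ha => ⟨hc a ha, (hl a ha).2⟩) h hlen)
      rw [wordEval_eq_zero ha (if_neg (by omega)), LinearMap.zero_apply]
  · rw [h0, if_neg, LinearMap.zero_apply]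
    intro hw
    rw [hw, len_blockRev] at h
    omega

end StaircaseWord

section Evaluation

/-! ### The sum over reduced words -/

open Polynomial Matrix

lemma sum_smul_pow {R A : Type*} [CommSemiring R] [Semiring A] [Algebra R A] {n : ℕ}
    (c : Fin n → R) (D : Fin n → A) (k : ℕ) :
    (∑ a, c a • D a) ^ k =
      ∑ w : Fin k → Fin n, (∏ i, c (w i)) • (List.ofFn fun i => D (w i)).prod := by
  induction k with
  | zero => simp
  | succ k ih =>
    rw [pow_succ', ih, ← (Fin.consEquiv fun _ => Fin n).sum_comp, Fintype.sum_prod_type,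
      Finset.sum_mul]
    refine Finset.sum_congr rfl fun a _ => ?_
    rw [Finset.mul_sum]
    refine Finset.sum_congr rfl fun w _ => ?_
    simp [Fin.consEquiv, Fin.prod_univ_succ, List.ofFn_succ, mul_smul, smul_comm (c a)]

lemma pow_apply_eq_of_commute {R M : Type*} [Semiring R] [AddCommMonoid M] [Module R M]
    {S T : Module.End R M} (h : Commute S T) {v : M} (hv : S v = T v) (k : ℕ) :
    (S ^ k) v = (T ^ k) v := by
  induction k with
  | zero => rfl
  | succ k ih =>
    rw [pow_succ, Module.End.mul_apply, hv, ← Module.End.mul_apply, (h.pow_left k).eq,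
      Module.End.mul_apply, ih, ← Module.End.mul_apply, ← pow_succ']

lemma ptDeriv_pow_apply (k : ℕ) (f : Pt → ℚ[X]) (y : Pt) :
    (ptDeriv ^ k) f y = derivative^[k] (f y) := by
  induction k generalizing f with
  | zero => rfl
  | succ k ih => rw [pow_succ, Module.End.mul_apply, ih, ptDeriv_apply, Function.iterate_succ_apply]

lemma upsilon_blockRev (m N : ℕ) (y : Pt) : Upsilon (m + 1 + N) (blockRev m (N + 1)) =
    (stairDet m (m + 1 + N) N y).coeff (∑ j ∈ Finset.range (N + 1), j) := by
  classical
  set n := m + 1 + N with hn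
  set P := stairDet m n N with hP
  set L := ∑ j ∈ Finset.range (N + 1), j with hL
  set T : Module.End ℚ (Pt → ℚ[X]) := ∑ a : Fin n, ((a : ℕ) : ℚ) • truncDiff m a with hT
  have hcomm : Commute ptDeriv T := by
    refine Commute.sum_right _ _ _ fun a _ => ?_
    exact (show Commute ptDeriv (truncDiff m a) from ptDeriv_mul_truncDiff m a).smul_right _
  have hPT : ptDeriv P = T P := by
    rw [hP, hn, ptDeriv_stairDet, hT, LinearMap.sum_apply, ← hn,
      ← Fin.sum_univ_eq_sum_range (fun a => (a : ℚ) • truncDiff m a (stairDet m n N))]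
    rfl
  have hword : ∀ w : Fin L → Fin n, (∏ i, ((w i : ℕ) : ℚ)) •
      (List.ofFn fun i => truncDiff m (w i)).prod P y =
      if (∀ i, 1 ≤ (w i : ℕ)) ∧ (List.ofFn fun i => sT (w i : ℕ)).prod = blockRev m (N + 1)
        then C (∏ i, ((w i : ℕ) : ℚ)) else 0 := by
    intro w
    by_cases h1 : ∀ i, 1 ≤ (w i : ℕ)
    · have h2 := wordEval_stairDet (m := m) (N := N)
        (l := (List.ofFn fun i => (w i : ℕ)).reverse) (fun a ha => by
          rw [List.mem_reverse, List.mem_ofFn] at ha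
          obtain ⟨i, rfl⟩ := ha
          exact ⟨h1 i, (w i).2⟩) (by simp [hL])
      rw [wordEval_eq_prod, wordPerm_eq_prod, List.reverse_reverse, List.map_ofFn,
        List.map_ofFn, ← hn, ← hP] at h2
      change (List.ofFn fun i => truncDiff m (w i)).prod P =
        if (List.ofFn fun i => sT (w i : ℕ)).prod = _ then 1 else 0 at h2
      rw [h2]
      by_cases h3 : (List.ofFn fun i => sT (w i : ℕ)).prod = blockRev m (N + 1)
      · rw [if_pos h3, if_pos ⟨h1, h3⟩, Pi.one_apply, smul_eq_C_mul, mul_one]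
      · rw [if_neg h3, if_neg fun h => h3 h.2, Pi.zero_apply, smul_zero]
    · rw [if_neg fun h => h1 h.1]
      push Not at h1
      obtain ⟨i, hi⟩ := h1
      rw [Finset.prod_eq_zero (Finset.mem_univ i), zero_smul]
      rw [Nat.lt_one_iff.1 hi, Nat.cast_zero]
  have key : derivative^[L] (P y) = ∑ w : Fin L → Fin n,
      if (∀ i, 1 ≤ (w i : ℕ)) ∧ (List.ofFn fun i => sT (w i : ℕ)).prod = blockRev m (N + 1)
        then C (∏ i, ((w i : ℕ) : ℚ)) else 0 := by
    rw [← ptDeriv_pow_apply, pow_apply_eq_of_commute hcomm hPT, hT, sum_smul_pow,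
      LinearMap.sum_apply, Finset.sum_apply]
    exact Finset.sum_congr rfl fun w _ => hword w
  have key2 := congrArg (fun p => p.coeff 0) key
  simp only [coeff_iterate_derivative, zero_add, Nat.descFactorial_self] at key2
  rw [← Finset.sum_filter, finsetSum_coeff] at key2
  simp only [coeff_C_zero] at key2
  have hlen : len n (blockRev m (N + 1)) = L := len_blockRev m N
  unfold Upsilon
  rw [hlen, inv_mul_eq_iff_eq_mul₀ (by positivity), ← nsmul_eq_mul, key2]

/-! ### Evaluation of the determinant -/

lemma coeff_prod_eq_of_natDegree_le {R ι : Type*} [CommSemiring R] (s : Finset ι)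
    (f : ι → R[X]) (d : ι → ℕ) (h : ∀ i ∈ s, (f i).natDegree ≤ d i) :
    (∏ i ∈ s, f i).coeff (∑ i ∈ s, d i) = ∏ i ∈ s, (f i).coeff (d i) := by
  classical
  induction s using Finset.induction_on with
  | empty => simp
  | insert i s hi ih =>
    rw [Finset.prod_insert hi, Finset.sum_insert hi, Finset.prod_insert hi,
      coeff_mul_add_eq_of_natDegree_le (h i (Finset.mem_insert_self i s))
        ((natDegree_prod_le _ _).trans (Finset.sum_le_sum fun j hj =>
          h j (Finset.mem_insert_of_mem hj))),
      ih fun j hj => h j (Finset.mem_insert_of_mem hj)]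

lemma coeff_stairDet (m n N : ℕ) (y : Pt) :
    (stairDet m n N y).coeff (∑ j ∈ Finset.range (N + 1), j) = (binomMatrix m N).det := by
  rw [stairDet_apply, det_apply, det_apply, finsetSum_coeff]
  refine Finset.sum_congr rfl fun σ _ => ?_
  rw [coeff_smul]
  congr 1
  by_cases h : ∀ c : Fin N, (c : ℕ) ≤ 2 * (σ c : ℕ) + 1
  · have hent : ∀ c : Fin N, stairMatrix m n N y (σ c) c =
        esym m n (σ c + 1) ((2 * (σ c : ℕ) + 1 - c : ℕ) : ℤ) y := by
      intro c
      rw [stairMatrix_apply, Nat.cast_sub (h c)]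
      congr 1
      push_cast
      ring
    have hsum : ∑ j ∈ Finset.range (N + 1), j = ∑ c : Fin N, (2 * (σ c : ℕ) + 1 - c) := by
      have h1 : ∑ c : Fin N, (2 * (σ c : ℕ) + 1 - c) + ∑ c : Fin N, (c : ℕ) =
          ∑ c : Fin N, (2 * (c : ℕ) + 1) := by
        rw [← Finset.sum_add_distrib, ← Equiv.sum_comp σ fun c : Fin N => 2 * (c : ℕ) + 1]
        exact Finset.sum_congr rfl fun c _ => Nat.sub_add_cancel (h c)
      have h2 : ∑ c : Fin N, (2 * (c : ℕ) + 1) =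
          ∑ j ∈ Finset.range (N + 1), j + ∑ c : Fin N, (c : ℕ) := by
        rw [Fin.sum_univ_eq_sum_range (fun c => 2 * c + 1),
          Fin.sum_univ_eq_sum_range (fun c => c), Finset.sum_range_succ',
          add_zero, ← Finset.sum_add_distrib]
        exact Finset.sum_congr rfl fun c _ => by ring
      omega
    rw [hsum, coeff_prod_eq_of_natDegree_le]
    · refine Finset.prod_congr rfl fun c _ => ?_
      rw [hent, coeff_esym, binomMatrix, of_apply, if_pos (h c), add_assoc]
    · intro c _
      rw [hent]
      exact natDegree_esym_le _ _ _
  · push Not at h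
    obtain ⟨c, hc⟩ := h
    rw [Finset.prod_eq_zero (Finset.mem_univ c), Finset.prod_eq_zero (Finset.mem_univ c),
      coeff_zero]
    · rw [binomMatrix, of_apply, if_neg (by omega)]
    · rw [stairMatrix_apply, esym_of_neg]
      omega

lemma F_succ (m N : ℕ) : F m (N + 1) = ∏ i ∈ Finset.range N, ∏ t ∈ Finset.range (i + 1),
    ((2 * m + i + t + 2 : ℝ) / (i + t + 2)) := by
  induction N with
  | zero => simp [F]
  | succ N ih =>
    have hI : Finset.Icc 1 (N + 1) = Finset.Ico 1 (N + 2) := by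
      ext
      simp only [Finset.mem_Icc, Finset.mem_Ico]
      omega
    rw [Finset.prod_range_succ, ← ih, F, F, Finset.prod_Icc_succ_top (by omega),
      Finset.Ioc_self, Finset.prod_empty, mul_one]
    have hstep : ∀ i ∈ Finset.Icc 1 (N + 1),
        ∏ j ∈ Finset.Ioc i (N + 1 + 1), (2 * (m : ℝ) + i + j - 1) / ((i : ℝ) + j - 1) =
        (∏ j ∈ Finset.Ioc i (N + 1), (2 * (m : ℝ) + i + j - 1) / ((i : ℝ) + j - 1)) *
          ((2 * (m : ℝ) + i + (N + 1 + 1 : ℕ) - 1) / ((i : ℝ) + (N + 1 + 1 : ℕ) - 1)) :=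
      fun i hi => Finset.prod_Ioc_succ_top (Finset.mem_Icc.1 hi).2 _
    rw [Finset.prod_congr rfl hstep, Finset.prod_mul_distrib]
    congr 1
    rw [hI, Finset.prod_Ico_eq_prod_range]
    refine Finset.prod_congr rfl fun t _ => ?_
    push_cast
    congr 1 <;> ring

end Evaluation

end Macdonald

/-- For `p ≥ 1` and `m ≥ 0`, the permutation `1^m × w₀(p) ∈ S_{m+p}` (which fixes
`1,…,m` and reverses the block `m+1,…,m+p`, i.e. `blockRev m p`) satisfies
`Υ_{1^m × w₀(p)} = ∏_{1 ≤ i < j ≤ p} (2m+i+j−1)/(i+j−1)`. -/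
theorem upsilon_one_cross_w0 (m p : ℕ) (hp : 1 ≤ p) :
    ((Upsilon (m + p) (blockRev m p) : ℚ) : ℝ) = F m p := by
  obtain ⟨N, rfl⟩ : ∃ N, p = N + 1 := ⟨p - 1, by omega⟩
  rw [show m + (N + 1) = m + 1 + N by ring,
    Macdonald.upsilon_blockRev m N ⟨fun i => (i : ℚ), Nat.cast_injective⟩,
    Macdonald.coeff_stairDet, Macdonald.det_binomMatrix, Macdonald.F_succ]
  push_cast
  rfl
end

section
/- For all integers m ≥ 0 and p ≥ 1, the product Π_{1 ≤ i < j ≤ p} (2m+i+j−1)/(i+j−1) equals Λ(2m+2p)·Λ(2m+1)·Φ(p) / (Φ(2m+p)·Λ(2p)). -/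
/-- The superfactorial `Φ(n) = 1!·2!···(n−1)!`. -/
def Phi (n : ℕ) : ℕ := ∏ k ∈ Finset.range n, k.factorial

/-- The double superfactorial `Λ(n) = (n−2)!·(n−4)!·(n−6)!···`, the product of `k!` over
`k ≤ n − 2` with `k ≡ n (mod 2)`; `Λ(n) = 1` for `n ≤ 1`. -/
def Lam (n : ℕ) : ℕ :=
  ∏ k ∈ (Finset.range (n - 1)).filter (fun k => k % 2 = n % 2), k.factorial

theorem Phi_succ (n : ℕ) : Phi (n + 1) = Phi n * n.factorial :=
  Finset.prod_range_succ _ n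

theorem Lam_add_two (n : ℕ) : Lam (n + 2) = Lam n * n.factorial := by
  unfold Lam
  have h : (Finset.range (n + 2 - 1)).filter (fun k => k % 2 = (n + 2) % 2)
      = insert n ((Finset.range (n - 1)).filter (fun k => k % 2 = n % 2)) := by
    ext k
    simp only [Finset.mem_filter, Finset.mem_range, Finset.mem_insert]
    omega
  rw [h, Finset.prod_insert (by simp), mul_comm]

theorem Lam_mul_Lam_succ (n : ℕ) : Lam n * Lam (n + 1) = Phi n := by
  induction n with
  | zero => simp [Lam, Phi]
  | succ n ih => rw [Phi_succ, ← ih, Lam_add_two]; ring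

theorem Phi_pos (n : ℕ) : 0 < Phi n :=
  Finset.prod_pos fun k _ => k.factorial_pos

theorem Lam_pos (n : ℕ) : 0 < Lam n :=
  Finset.prod_pos fun k _ => k.factorial_pos

theorem prod_Icc_add_eq_factorial_div (a q : ℕ) :
    ∏ i ∈ Finset.Icc 1 q, ((a : ℝ) + i) = ((a + q).factorial : ℝ) / (a.factorial : ℝ) := by
  have ha : (a.factorial : ℝ) ≠ 0 := by exact_mod_cast a.factorial_ne_zero
  induction q with
  | zero => simp [ha]
  | succ q ih =>
    rw [Finset.prod_Icc_succ_top (by omega), ih, ← add_assoc, Nat.factorial_succ]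
    push_cast
    ring

theorem F_succ (m p : ℕ) :
    F m (p + 1) = F m p * ∏ i ∈ Finset.Icc 1 p,
      (((2 * m + p : ℕ) : ℝ) + i) / ((p : ℝ) + i) := by
  unfold F
  rw [Finset.prod_Icc_succ_top (by omega), Finset.Ioc_self, Finset.prod_empty, mul_one,
    ← Finset.prod_mul_distrib]
  refine Finset.prod_congr rfl fun i hi => ?_
  rw [Finset.prod_Ioc_succ_top (Finset.mem_Icc.mp hi).2]
  push_cast
  congr 2 <;> ring

/-- For `m ≥ 0` and `p ≥ 1`:
`∏_{1 ≤ i < j ≤ p} (2m+i+j−1)/(i+j−1) = Λ(2m+2p)·Λ(2m+1)·Φ(p)/(Φ(2m+p)·Λ(2p))`. -/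
theorem F_superfactorial_formula (m p : ℕ) (hp : 1 ≤ p) :
    F m p = ((Lam (2 * m + 2 * p) : ℝ) * (Lam (2 * m + 1) : ℝ) * (Phi p : ℝ))
      / ((Phi (2 * m + p) : ℝ) * (Lam (2 * p) : ℝ)) := by
  clear hp
  have hPhi (n : ℕ) : (Phi n : ℝ) ≠ 0 := by exact_mod_cast (Phi_pos n).ne'
  have hLam (n : ℕ) : (Lam n : ℝ) ≠ 0 := by exact_mod_cast (Lam_pos n).ne'
  have hfac (n : ℕ) : (n.factorial : ℝ) ≠ 0 := by exact_mod_cast n.factorial_ne_zero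
  induction p with
  | zero =>
    have h : (Lam (2 * m) : ℝ) * Lam (2 * m + 1) = Phi (2 * m) := by
      exact_mod_cast Lam_mul_Lam_succ (2 * m)
    have hF : F m 0 = 1 := by simp [F]
    have hP : Phi 0 = 1 := rfl
    have hL : Lam 0 = 1 := rfl
    simp only [hF, mul_zero, add_zero, h, hP, hL, Nat.cast_one, mul_one]
    exact (div_self (hPhi _)).symm
  | succ p ih =>
    rw [F_succ, ih, Finset.prod_div_distrib, prod_Icc_add_eq_factorial_div,
      prod_Icc_add_eq_factorial_div, show 2 * m + 2 * (p + 1) = 2 * m + 2 * p + 2 by ring,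
      show 2 * (p + 1) = 2 * p + 2 by ring, ← add_assoc (2 * m) p 1, Phi_succ, Phi_succ,
      Lam_add_two, Lam_add_two, show 2 * m + p + p = 2 * m + 2 * p by ring,
      ← two_mul p]
    push_cast
    have h₁ := hPhi (2 * m + p)
    have h₂ := hLam (2 * p)
    have h₃ := hfac (2 * m + p)
    have h₄ := hfac p
    have h₅ := hfac (2 * p)
    field_simp
end
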